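/- arXiv:2010.05068 — 10 statements merged into one kernel-verified Lean document; each statement's English description precedes it below -/
import Mathlib

section
/- Let n ≥ 1, let V : ℝⁿ → ℝ be smooth, and let K_{ab}(t,q) (symmetric in a,b), K_a(t,q) and K(t,q) be smooth functions on ℝ × ℝⁿ. Then the quantity I(t,q,q̇) = K_{ab}(t,q) q̇^a q̇^b + K_a(t,q) q̇^a + K(t,q) is constant along every C² solution q : J → ℝⁿ of the Newtonian equations q̈^a = −∂V/∂q^a (J an open interval) if and only if the following four identities hold at every (t,q): (i) ∂_{(c}K_{ab)} = 0 (the symmetrized spatial derivative of K_{ab} vanishes, i.e. K_{ab} is a second-order Killing tensor of the Euclidean metric for each t); (ii) ∂K_{ab}/∂t + ∂_{(a}K_{b)} = 0; (iii) −2 K_{ab} ∂V/∂q^b + ∂K_a/∂t + ∂K/∂q^a = 0; (iv) ∂K/∂t − K_a ∂V/∂q^a = 0. (Here round brackets denote symmetrization over the enclosed indices and repeated indices are summed.) -/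
open Real Set
open scoped ContDiff

/-- Partial derivative of a scalar field on `ℝⁿ` with respect to the `a`-th coordinate. -/
noncomputable def pd {n : ℕ} (f : (Fin n → ℝ) → ℝ) (q : Fin n → ℝ) (a : Fin n) : ℝ :=
  fderiv ℝ f q (Pi.single a 1)

/-- The chain rule for a function of time and position along a curve, in coordinates. -/
lemma hasDerivAt_comp_curve {n : ℕ} {f : ℝ → (Fin n → ℝ) → ℝ}
    (hf : ContDiff ℝ ∞ (fun p : ℝ × (Fin n → ℝ) => f p.1 p.2))
    {q : ℝ → Fin n → ℝ} {v : Fin n → ℝ} {t : ℝ} (hq : HasDerivAt q v t) :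
    HasDerivAt (fun s => f s (q s))
      (deriv (fun s => f s (q t)) t + ∑ c, v c * pd (fun x => f t x) (q t) c) t := by
  have hd : HasFDerivAt (fun p : ℝ × (Fin n → ℝ) => f p.1 p.2) _ (t, q t) :=
    (hf.differentiable (by simp) (t, q t)).hasFDerivAt
  have htime : deriv (fun s => f s (q t)) t =
      fderiv ℝ (fun p : ℝ × (Fin n → ℝ) => f p.1 p.2) (t, q t) (1, 0) := by
    have hc : HasDerivAt (fun s : ℝ => (s, q t)) (1, 0) t :=
      (hasDerivAt_id t).prodMk (hasDerivAt_const t (q t))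
    exact (hd.comp_hasDerivAt t hc).deriv
  have hspace (w : Fin n → ℝ) : fderiv ℝ (fun x => f t x) (q t) w =
      fderiv ℝ (fun p : ℝ × (Fin n → ℝ) => f p.1 p.2) (t, q t) (0, w) := by
    have hc : HasFDerivAt (fun x : Fin n → ℝ => (t, x)) _ (q t) :=
      hasFDerivAt_prodMk_right (𝕜 := ℝ) t (q t)
    have := (hd.comp (q t) hc).fderiv
    simp only [Function.comp_def] at this
    rw [this]
    simp
  have hc : HasDerivAt (fun s => (s, q s)) (1, v) t := (hasDerivAt_id t).prodMk hq
  refine (hd.comp_hasDerivAt t hc).congr_deriv ?_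
  have hv : ∑ c, v c * pd (fun x => f t x) (q t) c = fderiv ℝ (fun x => f t x) (q t) v := by
    conv_rhs => rw [pi_eq_sum_univ' v]
    simp [pd]
  rw [hv, hspace, htime, ← map_add]
  simp

/-- A cubic form, symmetric in its first two indices, vanishes identically only if its coefficients
vanish after cyclic symmetrization. -/
lemma cyclic_sum_eq_zero_of_cubic_eq_zero {n : ℕ} {T : Fin n → Fin n → Fin n → ℝ}
    (hT : ∀ a b c, T a b c = T b a c)
    (h : ∀ v : Fin n → ℝ, ∑ a, ∑ b, ∑ c, T a b c * v a * v b * v c = 0) (a b c : Fin n) :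
    T a b c + T b c a + T c a b = 0 := by
  let B : (Fin n → ℝ) → (Fin n → ℝ) → (Fin n → ℝ) → ℝ :=
    fun u v w => ∑ a, ∑ b, ∑ c, T a b c * u a * v b * w c
  have h1 (u u' v w) : B (u + u') v w = B u v w + B u' v w := by
    simp [B, mul_add, add_mul, Finset.sum_add_distrib]
  have h2 (u v v' w) : B u (v + v') w = B u v w + B u v' w := by
    simp [B, mul_add, add_mul, Finset.sum_add_distrib]
  have h3 (u v w w') : B u v (w + w') = B u v w + B u v w' := by
    simp [B, mul_add, Finset.sum_add_distrib]
  have hB (a b c) : B (Pi.single a 1) (Pi.single b 1) (Pi.single c 1) = T a b c := by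
    simp [B, Pi.single_apply]
  have h0 (v) : B v v v = 0 := h v
  have key (u v w) :
      B u v w + B v u w + B v w u + B w v u + B w u v + B u w v = 0 := by
    have e1 := h0 (u + v + w)
    have e2 := h0 (u + v)
    have e3 := h0 (v + w)
    have e4 := h0 (u + w)
    simp only [h1, h2, h3, h0] at e1 e2 e3 e4
    linarith
  have := key (Pi.single a 1) (Pi.single b 1) (Pi.single c 1)
  simp only [hB] at this
  linarith [hT a b c, hT b c a, hT c a b]

/-- A quadratic form vanishes identically only if its coefficients are antisymmetric. -/
lemma add_swap_eq_zero_of_quadratic_eq_zero {n : ℕ} {Q : Fin n → Fin n → ℝ}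
    (h : ∀ v : Fin n → ℝ, ∑ a, ∑ b, Q a b * v a * v b = 0) (a b : Fin n) :
    Q a b + Q b a = 0 := by
  let B : (Fin n → ℝ) → (Fin n → ℝ) → ℝ := fun u v => ∑ a, ∑ b, Q a b * u a * v b
  have h1 (u u' v) : B (u + u') v = B u v + B u' v := by
    simp [B, mul_add, add_mul, Finset.sum_add_distrib]
  have h2 (u v v') : B u (v + v') = B u v + B u v' := by
    simp [B, mul_add, Finset.sum_add_distrib]
  have hB (a b) : B (Pi.single a 1) (Pi.single b 1) = Q a b := by
    simp [B, Pi.single_apply]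
  have h0 (v) : B v v = 0 := h v
  have key := h0 (Pi.single a 1 + Pi.single b 1)
  simp only [h1, h2, h0, hB] at key
  linarith

/-- The vanishing of a polynomial of degree at most three in `v`, in terms of its coefficients. -/
lemma cubic_polynomial_eq_zero_iff {n : ℕ} {T : Fin n → Fin n → Fin n → ℝ}
    (hT : ∀ a b c, T a b c = T b a c) (Q : Fin n → Fin n → ℝ) (L : Fin n → ℝ) (C : ℝ) :
    (∀ v : Fin n → ℝ, (∑ a, ∑ b, ∑ c, T a b c * v a * v b * v c)
        + (∑ a, ∑ b, Q a b * v a * v b) + (∑ a, L a * v a) + C = 0) ↔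
      (∀ a b c, T a b c + T b c a + T c a b = 0) ∧ (∀ a b, Q a b + Q b a = 0) ∧
        (∀ a, L a = 0) ∧ C = 0 := by
  constructor
  · intro h
    have hsmul (s : ℝ) (v : Fin n → ℝ) :
        s ^ 3 * (∑ a, ∑ b, ∑ c, T a b c * v a * v b * v c)
          + s ^ 2 * (∑ a, ∑ b, Q a b * v a * v b) + s * (∑ a, L a * v a) + C = 0 := by
      rw [← h (s • v)]
      simp only [Finset.mul_sum, Pi.smul_apply, smul_eq_mul]
      refine congrArg₂ (· + ·) (congrArg₂ (· + ·) (congrArg₂ (· + ·) ?_ ?_) ?_) rfl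
      · refine Finset.sum_congr rfl fun a _ => Finset.sum_congr rfl fun b _ =>
          Finset.sum_congr rfl fun c _ => ?_
        ring
      · refine Finset.sum_congr rfl fun a _ => Finset.sum_congr rfl fun b _ => ?_
        ring
      · refine Finset.sum_congr rfl fun a _ => ?_
        ring
    have hC : C = 0 := by simpa using hsmul 0 0
    refine ⟨cyclic_sum_eq_zero_of_cubic_eq_zero hT fun v => ?_,
      add_swap_eq_zero_of_quadratic_eq_zero fun v => ?_, fun a => ?_, hC⟩
    · linarith [hsmul 1 v, hsmul (-1) v, hsmul 2 v]
    · linarith [hsmul 1 v, hsmul (-1) v, hsmul 2 v]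
    · have : ∑ b, L b * (Pi.single a 1 : Fin n → ℝ) b = 0 := by
        linarith [hsmul 1 (Pi.single a 1), hsmul (-1) (Pi.single a 1), hsmul 2 (Pi.single a 1)]
      simpa [Pi.single_apply] using this
  · rintro ⟨h3, h2, h1, h0⟩ v
    have e3 : ∑ a, ∑ b, ∑ c, T a b c * v a * v b * v c = 0 := by
      have r1 : ∑ a, ∑ b, ∑ c, T a b c * v a * v b * v c
          = ∑ a, ∑ b, ∑ c, T b c a * v a * v b * v c := by
        rw [Finset.sum_comm_cycle]
        refine Finset.sum_congr rfl fun a _ => Finset.sum_congr rfl fun b _ =>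
          Finset.sum_congr rfl fun c _ => ?_
        ring
      have r2 : ∑ a, ∑ b, ∑ c, T a b c * v a * v b * v c
          = ∑ a, ∑ b, ∑ c, T c a b * v a * v b * v c := by
        rw [← Finset.sum_comm_cycle]
        refine Finset.sum_congr rfl fun a _ => Finset.sum_congr rfl fun b _ =>
          Finset.sum_congr rfl fun c _ => ?_
        ring
      have r3 : ∑ a, ∑ b, ∑ c, (T a b c + T b c a + T c a b) * v a * v b * v c = 0 := by
        simp [h3]
      simp only [add_mul, Finset.sum_add_distrib] at r3
      linarith
    have e2 : ∑ a, ∑ b, Q a b * v a * v b = 0 := by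
      have r1 : ∑ a, ∑ b, Q a b * v a * v b = ∑ a, ∑ b, Q b a * v a * v b := by
        rw [Finset.sum_comm]
        refine Finset.sum_congr rfl fun a _ => Finset.sum_congr rfl fun b _ => ?_
        ring
      have r2 : ∑ a, ∑ b, (Q a b + Q b a) * v a * v b = 0 := by simp [h2]
      simp only [add_mul, Finset.sum_add_distrib] at r2
      linarith
    simp [e3, e2, h1, h0]

/-- Newtonian equations with a smooth potential have local solutions for all initial data. -/
lemma exists_local_newtonian_solution {n : ℕ} {V : (Fin n → ℝ) → ℝ} (hV : ContDiff ℝ ∞ V)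
    (t₀ : ℝ) (x v : Fin n → ℝ) :
    ∃ q q' : ℝ → Fin n → ℝ, q t₀ = x ∧ q' t₀ = v ∧ ∃ ε > (0 : ℝ),
      ∀ t ∈ Ioo (t₀ - ε) (t₀ + ε),
        HasDerivAt q (q' t) t ∧ HasDerivAt q' (fun a => -pd V (q t) a) t := by
  have hpd (a : Fin n) : ContDiff ℝ 1 (fun x => pd V x a) :=
    (hV.fderiv_right (m := 1) (by norm_cast)).clm_apply contDiff_const
  have hfield : ContDiff ℝ 1 (fun p : (Fin n → ℝ) × (Fin n → ℝ) =>
      (p.2, fun a => -pd V p.1 a)) :=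
    contDiff_snd.prodMk (contDiff_pi.2 fun a => ((hpd a).comp contDiff_fst).neg)
  obtain ⟨α, hα, ε, hε, h⟩ :=
    (hfield.contDiffAt (x := (x, v))
      ).exists_forall_mem_closedBall_exists_eq_forall_mem_Ioo_hasDerivAt₀ t₀
  refine ⟨fun t => (α t).1, fun t => (α t).2, by simp [hα], by simp [hα], ε, hε, fun t ht => ?_⟩
  exact ⟨(hasFDerivAt_fst (p := α t)).comp_hasDerivAt t (h t ht),
    (hasFDerivAt_snd (p := α t)).comp_hasDerivAt t (h t ht)⟩

/-- The time derivative of `K_{ab} q̇^a q̇^b + K_a q̇^a + K` along a solution of the Newtonian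
equations, arranged by degree in the velocities. -/
lemma hasDerivAt_quadratic_along_solution {n : ℕ} {V : (Fin n → ℝ) → ℝ}
    {Kab : ℝ → (Fin n → ℝ) → Fin n → Fin n → ℝ} {Ka : ℝ → (Fin n → ℝ) → Fin n → ℝ}
    {K : ℝ → (Fin n → ℝ) → ℝ}
    (hKab : ∀ a b, ContDiff ℝ ∞ (fun p : ℝ × (Fin n → ℝ) => Kab p.1 p.2 a b))
    (hKabsym : ∀ t q a b, Kab t q a b = Kab t q b a)
    (hKa : ∀ a, ContDiff ℝ ∞ (fun p : ℝ × (Fin n → ℝ) => Ka p.1 p.2 a))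
    (hK : ContDiff ℝ ∞ (fun p : ℝ × (Fin n → ℝ) => K p.1 p.2))
    {q q' : ℝ → Fin n → ℝ} {t : ℝ} (hq : HasDerivAt q (q' t) t)
    (hq' : HasDerivAt q' (fun a => -pd V (q t) a) t) :
    HasDerivAt (fun s => (∑ a, ∑ b, Kab s (q s) a b * q' s a * q' s b)
        + (∑ a, Ka s (q s) a * q' s a) + K s (q s))
      ((∑ a, ∑ b, ∑ c, pd (fun x => Kab t x a b) (q t) c * q' t a * q' t b * q' t c)
        + (∑ a, ∑ b, (deriv (fun s => Kab s (q t) a b) t + pd (fun x => Ka t x a) (q t) b)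
            * q' t a * q' t b)
        + (∑ a, (-2 * (∑ b, Kab t (q t) a b * pd V (q t) b)
            + deriv (fun s => Ka s (q t) a) t + pd (fun x => K t x) (q t) a) * q' t a)
        + (deriv (fun s => K s (q t)) t - ∑ a, Ka t (q t) a * pd V (q t) a)) t := by
  have hv (a : Fin n) : HasDerivAt (fun s => q' s a) (-pd V (q t) a) t := hasDerivAt_pi.1 hq' a
  have d2 := HasDerivAt.fun_sum (u := Finset.univ) fun a _ =>
    HasDerivAt.fun_sum (u := Finset.univ) fun b _ =>
      ((hasDerivAt_comp_curve (f := fun s x => Kab s x a b) (hKab a b) hq).mul (hv a)).mul (hv b)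
  have d1 := HasDerivAt.fun_sum (u := Finset.univ) fun a _ =>
    (hasDerivAt_comp_curve (f := fun s x => Ka s x a) (hKa a) hq).mul (hv a)
  refine ((d2.add d1).add (hasDerivAt_comp_curve hK hq)).congr_deriv ?_
  have swap : ∑ a, ∑ b, Kab t (q t) a b * pd V (q t) a * q' t b
      = ∑ a, ∑ b, Kab t (q t) a b * q' t a * pd V (q t) b := by
    rw [Finset.sum_comm]
    refine Finset.sum_congr rfl fun a _ => Finset.sum_congr rfl fun b _ => ?_
    rw [hKabsym]
    ring
  have cubic : ∑ a, ∑ b, ∑ c, pd (fun x => Kab t x a b) (q t) c * q' t a * q' t b * q' t c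
      = ∑ a, ∑ b, (∑ c, q' t c * pd (fun x => Kab t x a b) (q t) c) * q' t a * q' t b := by
    simp only [Finset.sum_mul]
    refine Finset.sum_congr rfl fun a _ => Finset.sum_congr rfl fun b _ =>
          Finset.sum_congr rfl fun c _ => ?_
    ring
  have quad : ∑ a, ∑ b, pd (fun x => Ka t x a) (q t) b * q' t a * q' t b
      = ∑ a, (∑ b, q' t b * pd (fun x => Ka t x a) (q t) b) * q' t a := by
    simp only [Finset.sum_mul]
    refine Finset.sum_congr rfl fun a _ => Finset.sum_congr rfl fun b _ => ?_
    ring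
  have lin : ∑ a, (-2 * (∑ b, Kab t (q t) a b * pd V (q t) b)) * q' t a
      = -2 * ∑ a, ∑ b, Kab t (q t) a b * q' t a * pd V (q t) b := by
    simp only [Finset.sum_mul, Finset.mul_sum]
    refine Finset.sum_congr rfl fun a _ => Finset.sum_congr rfl fun b _ => ?_
    ring
  have grad : ∑ a, pd (fun x => K t x) (q t) a * q' t a
      = ∑ a, q' t a * pd (fun x => K t x) (q t) a := by
    simp only [mul_comm]
  simp only [Pi.mul_apply, add_mul, Finset.sum_add_distrib, mul_neg, neg_mul, Finset.sum_neg_distrib]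
    at cubic quad lin swap grad ⊢
  linarith

/-- The quantity `I = K_{ab} q̇^a q̇^b + K_a q̇^a + K` is a first integral of the Newtonian
equations `q̈^a = −∂V/∂q^a` (i.e. it is constant along every C² solution defined on an
open interval) if and only if the four identities (i)–(iv) hold everywhere:
(i) `K_{ab}` is a second-order Killing tensor of the Euclidean metric for each `t`;
(ii) `∂_t K_{ab} + ∂_{(a}K_{b)} = 0`; (iii) `−2K_{ab}∂_bV + ∂_tK_a + ∂_aK = 0`;
(iv) `∂_tK − K_a ∂_aV = 0`. -/
theorem stmt0 (n : ℕ) (hn : 1 ≤ n) (V : (Fin n → ℝ) → ℝ) (hV : ContDiff ℝ ∞ V)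
    (Kab : ℝ → (Fin n → ℝ) → Fin n → Fin n → ℝ)
    (Ka : ℝ → (Fin n → ℝ) → Fin n → ℝ)
    (K : ℝ → (Fin n → ℝ) → ℝ)
    (hKab : ∀ a b, ContDiff ℝ ∞ (fun p : ℝ × (Fin n → ℝ) => Kab p.1 p.2 a b))
    (hKabsym : ∀ t q a b, Kab t q a b = Kab t q b a)
    (hKa : ∀ a, ContDiff ℝ ∞ (fun p : ℝ × (Fin n → ℝ) => Ka p.1 p.2 a))
    (hK : ContDiff ℝ ∞ (fun p : ℝ × (Fin n → ℝ) => K p.1 p.2)) :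
    (∀ (aJ bJ : ℝ) (q q' q'' : ℝ → Fin n → ℝ),
        (∀ t ∈ Ioo aJ bJ, HasDerivAt q (q' t) t) →
        (∀ t ∈ Ioo aJ bJ, HasDerivAt q' (q'' t) t) →
        (∀ t ∈ Ioo aJ bJ, ∀ a, q'' t a = -pd V (q t) a) →
        ∀ t₁ ∈ Ioo aJ bJ, ∀ t₂ ∈ Ioo aJ bJ,
          (∑ a, ∑ b, Kab t₁ (q t₁) a b * q' t₁ a * q' t₁ b)
            + (∑ a, Ka t₁ (q t₁) a * q' t₁ a) + K t₁ (q t₁)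
          = (∑ a, ∑ b, Kab t₂ (q t₂) a b * q' t₂ a * q' t₂ b)
            + (∑ a, Ka t₂ (q t₂) a * q' t₂ a) + K t₂ (q t₂))
    ↔
    ((∀ t q a b c,
        pd (fun q => Kab t q a b) q c + pd (fun q => Kab t q b c) q a
          + pd (fun q => Kab t q c a) q b = 0) ∧
     (∀ t q a b,
        deriv (fun s => Kab s q a b) t
          + (pd (fun q => Ka t q b) q a + pd (fun q => Ka t q a) q b) / 2 = 0) ∧
     (∀ t q a,
        -2 * (∑ b, Kab t q a b * pd V q b)
          + deriv (fun s => Ka s q a) t + pd (fun q => K t q) q a = 0) ∧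
     (∀ t q,
        deriv (fun s => K s q) t - (∑ a, Ka t q a * pd V q a) = 0)) := by
  have hsym (t q a b c) : pd (fun q => Kab t q a b) q c = pd (fun q => Kab t q b a) q c := by
    simp only [hKabsym t _ a b]
  have poly (t : ℝ) (q : Fin n → ℝ) :=
    cubic_polynomial_eq_zero_iff (T := fun a b c => pd (fun x => Kab t x a b) q c)
      (fun a b c => hsym t q a b c)
      (fun a b => deriv (fun s => Kab s q a b) t + pd (fun x => Ka t x a) q b)
      (fun a => -2 * (∑ b, Kab t q a b * pd V q b)
            + deriv (fun s => Ka s q a) t + pd (fun x => K t x) q a)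
      (deriv (fun s => K s q) t - ∑ a, Ka t q a * pd V q a)
  have hdsym (t q a b) : deriv (fun s => Kab s q a b) t = deriv (fun s => Kab s q b a) t := by
    simp only [hKabsym _ q a b]
  constructor
  · intro h
    have coeff (t q) := (poly t q).1 fun v => by
      obtain ⟨x, x', rfl, rfl, ε, hε, hx⟩ := exists_local_newtonian_solution hV t q v
      have hd := hasDerivAt_quadratic_along_solution hKab hKabsym hKa hK
        (hx t ⟨by linarith, by linarith⟩).1 (hx t ⟨by linarith, by linarith⟩).2
      have hev : (fun s => (∑ a, ∑ b, Kab s (x s) a b * x' s a * x' s b)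
          + (∑ a, Ka s (x s) a * x' s a) + K s (x s)) =ᶠ[nhds t] fun _ =>
            (∑ a, ∑ b, Kab t (x t) a b * x' t a * x' t b)
          + (∑ a, Ka t (x t) a * x' t a) + K t (x t) := by
        filter_upwards [Ioo_mem_nhds (a := t - ε) (b := t + ε) (by linarith) (by linarith)]
          with s hs
        exact h _ _ x x' _ (fun r hr => (hx r hr).1) (fun r hr => (hx r hr).2)
          (fun _ _ _ => rfl) s hs t ⟨by linarith, by linarith⟩
      exact hd.unique ((hasDerivAt_const t _).congr_of_eventuallyEq hev)
    refine ⟨fun t q a b c => (coeff t q).1 a b c, fun t q a b => ?_,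
      fun t q => (coeff t q).2.2.1, fun t q => (coeff t q).2.2.2⟩
    linarith [(coeff t q).2.1 a b, hdsym t q a b]
  · rintro ⟨h1, h2, h3, h4⟩ aJ bJ q q' q'' hq hq' hN t₁ ht₁ t₂ ht₂
    have hd (t) (ht : t ∈ Ioo aJ bJ) := by
      have hacc := hq' t ht
      rw [funext (hN t ht)] at hacc
      have := hasDerivAt_quadratic_along_solution hKab hKabsym hKa hK (hq t ht) hacc
      rwa [(poly t (q t)).2 ⟨h1 t (q t), fun a b => by
        linarith [h2 t (q t) a b, hdsym t (q t) a b], h3 t (q t), h4 t (q t)⟩ (q' t)] at this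
    exact isOpen_Ioo.is_const_of_deriv_eq_zero isPreconnected_Ioo
      (fun t ht => (hd t ht).differentiableAt.differentiableWithinAt)
      (fun t ht => (hd t ht).deriv) ht₁ ht₂
end

section
/- (Integral 3 of the main Theorem, Euclidean case.) Let n ≥ 1, V : ℝⁿ → ℝ smooth and λ ≠ 0 a real constant. Suppose L_a(q) is a smooth vector field on ℝⁿ such that L_{(a,b)} is a second-order Killing tensor of the Euclidean metric and such that ∂_a(L_b ∂_b V) = −2 L_{(a,b)} ∂_b V − λ² L_a. Then I₃ = e^{λt} ( −L_{(a,b)} q̇^a q̇^b + λ L_a q̇^a + L_a ∂_a V ) is constant along every C² solution of q̈^a = −∂V/∂q^a. -/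
open Real Set
open scoped ContDiff

/-- The symmetrized derivative `L_{(a,b)} = (∂_a L_b + ∂_b L_a)/2` of a vector field on `ℝⁿ`. -/
noncomputable def symD {n : ℕ} (L : (Fin n → ℝ) → Fin n → ℝ) (q : Fin n → ℝ) (a b : Fin n) : ℝ :=
  (pd (fun q => L q b) q a + pd (fun q => L q a) q b) / 2

/-- Chain rule along a curve, in terms of partial derivatives. -/
theorem HasDerivAt.comp_pd {n : ℕ} {f : (Fin n → ℝ) → ℝ} {q : ℝ → Fin n → ℝ} {v : Fin n → ℝ}
    {t : ℝ} (hf : Differentiable ℝ f) (hq : HasDerivAt q v t) :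
    HasDerivAt (fun s => f (q s)) (∑ a, pd f (q t) a * v a) t := by
  have h := (hf (q t)).hasFDerivAt.comp_hasDerivAt t hq
  have e : fderiv ℝ f (q t) v = ∑ a, pd f (q t) a * v a := by
    conv_lhs => rw [pi_eq_sum_univ' v]
    simp only [map_sum, map_smul, smul_eq_mul, pd, mul_comm]
  rw [← e]
  exact h

theorem ContDiff.pd {n : ℕ} {f : (Fin n → ℝ) → ℝ} (hf : ContDiff ℝ ∞ f) (a : Fin n) :
    ContDiff ℝ ∞ (fun q => _root_.pd f q a) :=
  (hf.fderiv_right (m := ∞) le_rfl).clm_apply contDiff_const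

theorem ContDiff.symD {n : ℕ} {L : (Fin n → ℝ) → Fin n → ℝ}
    (hL : ∀ a, ContDiff ℝ ∞ (fun q => L q a)) (a b : Fin n) :
    ContDiff ℝ ∞ (fun q => _root_.symD L q a b) :=
  (((hL b).pd a).add ((hL a).pd b)).div_const 2

theorem symD_comm {n : ℕ} (L : (Fin n → ℝ) → Fin n → ℝ) (q : Fin n → ℝ) (a b : Fin n) :
    symD L q a b = symD L q b a := by
  rw [symD, symD, add_comm]

/-- The symmetrized derivative and the full derivative define the same quadratic form. -/
theorem sum_symD_mul_mul {n : ℕ} (L : (Fin n → ℝ) → Fin n → ℝ) (q v : Fin n → ℝ) :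
    ∑ a, ∑ b, symD L q a b * v a * v b
      = ∑ a, (∑ b, pd (fun q => L q a) q b * v b) * v a := by
  have h : ∑ a, ∑ b, pd (fun q => L q b) q a * v a * v b
      = ∑ a, ∑ b, pd (fun q => L q a) q b * v a * v b := by
    rw [Finset.sum_comm]
    exact Finset.sum_congr rfl fun a _ => Finset.sum_congr rfl fun b _ => by ring
  calc ∑ a, ∑ b, symD L q a b * v a * v b
      = ((∑ a, ∑ b, pd (fun q => L q b) q a * v a * v b)
          + ∑ a, ∑ b, pd (fun q => L q a) q b * v a * v b) / 2 := by
        simp only [← Finset.sum_add_distrib, Finset.sum_div, symD]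
        exact Finset.sum_congr rfl fun a _ => Finset.sum_congr rfl fun b _ => by ring
    _ = ∑ a, ∑ b, pd (fun q => L q a) q b * v a * v b := by rw [h]; ring
    _ = _ := by
        simp only [Finset.sum_mul]
        exact Finset.sum_congr rfl fun a _ => Finset.sum_congr rfl fun b _ => by ring

/-- A three-index array with vanishing cyclic sum defines the zero cubic form. -/
theorem sum_mul_mul_mul_eq_zero_of_cyclic {n : ℕ} (T : Fin n → Fin n → Fin n → ℝ)
    (hT : ∀ a b c, T a b c + T b c a + T c a b = 0) (v : Fin n → ℝ) :
    ∑ a, ∑ b, ∑ c, T a b c * v c * v a * v b = 0 := by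
  have h1 : ∑ a, ∑ b, ∑ c, T b c a * v c * v a * v b
      = ∑ a, ∑ b, ∑ c, T a b c * v c * v a * v b := by
    rw [Finset.sum_comm]
    refine Finset.sum_congr rfl fun a _ => ?_
    rw [Finset.sum_comm]
    exact Finset.sum_congr rfl fun b _ => Finset.sum_congr rfl fun c _ => by ring
  have h2 : ∑ a, ∑ b, ∑ c, T c a b * v c * v a * v b
      = ∑ a, ∑ b, ∑ c, T b c a * v c * v a * v b := by
    rw [Finset.sum_comm]
    refine Finset.sum_congr rfl fun a _ => ?_
    rw [Finset.sum_comm]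
    exact Finset.sum_congr rfl fun b _ => Finset.sum_congr rfl fun c _ => by ring
  have h3 : (∑ a, ∑ b, ∑ c, T a b c * v c * v a * v b)
      + (∑ a, ∑ b, ∑ c, T b c a * v c * v a * v b)
      + ∑ a, ∑ b, ∑ c, T c a b * v c * v a * v b = 0 := by
    simp only [← Finset.sum_add_distrib, ← add_mul, hT, zero_mul, Finset.sum_const_zero]
  linarith

/-- Integral 3 of the main Theorem (Euclidean case): for `λ ≠ 0` and a vector field `L_a`
whose symmetrized derivative is a Killing tensor and which satisfies
`∂_a(L_b∂_bV) = −2L_{(a,b)}∂_bV − λ²L_a`, the quantity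
`I₃ = e^{λt}(−L_{(a,b)}q̇^aq̇^b + λL_aq̇^a + L_a∂_aV)` is constant along every C² solution
of `q̈^a = −∂V/∂q^a`. -/
theorem stmt3 (n : ℕ) (hn : 1 ≤ n) (V : (Fin n → ℝ) → ℝ) (hV : ContDiff ℝ ∞ V)
    (lam : ℝ) (hlam : lam ≠ 0)
    (L : (Fin n → ℝ) → Fin n → ℝ)
    (hLsmooth : ∀ a, ContDiff ℝ ∞ (fun q => L q a))
    (hLKT : ∀ q a b c,
      pd (fun q => symD L q a b) q c + pd (fun q => symD L q b c) q a
        + pd (fun q => symD L q c a) q b = 0)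
    (hLV : ∀ q a,
      pd (fun q => ∑ b, L q b * pd V q b) q a
        = -2 * (∑ b, symD L q a b * pd V q b) - lam^2 * L q a)
    (aJ bJ : ℝ) (q q' q'' : ℝ → Fin n → ℝ)
    (hq : ∀ t ∈ Ioo aJ bJ, HasDerivAt q (q' t) t)
    (hq' : ∀ t ∈ Ioo aJ bJ, HasDerivAt q' (q'' t) t)
    (heq : ∀ t ∈ Ioo aJ bJ, ∀ a, q'' t a = -pd V (q t) a) :
    ∀ t₁ ∈ Ioo aJ bJ, ∀ t₂ ∈ Ioo aJ bJ,
      exp (lam * t₁) * (-(∑ a, ∑ b, symD L (q t₁) a b * q' t₁ a * q' t₁ b)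
        + lam * (∑ a, L (q t₁) a * q' t₁ a)
        + (∑ a, L (q t₁) a * pd V (q t₁) a))
      = exp (lam * t₂) * (-(∑ a, ∑ b, symD L (q t₂) a b * q' t₂ a * q' t₂ b)
        + lam * (∑ a, L (q t₂) a * q' t₂ a)
        + (∑ a, L (q t₂) a * pd V (q t₂) a)) := by
  have hS : ∀ a b, Differentiable ℝ (fun q => symD L q a b) := fun a b =>
    (ContDiff.symD hLsmooth a b).differentiable (by simp)
  have hL : ∀ a, Differentiable ℝ (fun q => L q a) := fun a =>
    (hLsmooth a).differentiable (by simp)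
  have hLdV : Differentiable ℝ (fun q => ∑ b, L q b * pd V q b) :=
    (ContDiff.sum fun b _ => (hLsmooth b).mul (hV.pd b)).differentiable (by simp)
  have key : ∀ t ∈ Ioo aJ bJ, HasDerivAt (fun t =>
      exp (lam * t) * (-(∑ a, ∑ b, symD L (q t) a b * q' t a * q' t b)
        + lam * (∑ a, L (q t) a * q' t a)
        + (∑ a, L (q t) a * pd V (q t) a))) 0 t := by
    intro t ht
    have hv : ∀ a, HasDerivAt (fun s => q' s a) (-pd V (q t) a) t := fun a => by
      rw [← heq t ht a]
      exact hasDerivAt_pi.1 (hq' t ht) a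
    have dE : HasDerivAt (fun s => exp (lam * s)) (exp (lam * t) * lam) t := by
      simpa using ((hasDerivAt_id t).const_mul lam).exp
    have dK := HasDerivAt.fun_sum (u := Finset.univ) fun a _ =>
      HasDerivAt.fun_sum (u := Finset.univ) fun b _ =>
        (((hq t ht).comp_pd (hS a b)).mul (hv a)).mul (hv b)
    have dM := HasDerivAt.fun_sum (u := Finset.univ) fun a _ =>
      ((hq t ht).comp_pd (hL a)).mul (hv a)
    have dP := (hq t ht).comp_pd hLdV
    refine (dE.mul ((dK.neg.add (dM.const_mul lam)).add dP)).congr_deriv ?_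
    have cubic := sum_mul_mul_mul_eq_zero_of_cyclic
      (fun a b c => pd (fun q => symD L q a b) (q t) c) (fun a b c => hLKT (q t) a b c) (q' t)
    have quad := sum_symD_mul_mul L (q t) (q' t)
    have swap : ∑ a, ∑ b, symD L (q t) a b * pd V (q t) a * q' t b
        = ∑ a, ∑ b, symD L (q t) a b * pd V (q t) b * q' t a := by
      rw [Finset.sum_comm]
      exact Finset.sum_congr rfl fun a _ => Finset.sum_congr rfl fun b _ => by
        rw [symD_comm]
    have eK : ∑ a, ∑ b, (((∑ c, pd (fun q => symD L q a b) (q t) c * q' t c) * q' t a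
          + symD L (q t) a b * -pd V (q t) a) * q' t b
          + symD L (q t) a b * q' t a * -pd V (q t) b)
        = -2 * ∑ a, ∑ b, symD L (q t) a b * pd V (q t) b * q' t a := by
      have : ∑ a, ∑ b, (((∑ c, pd (fun q => symD L q a b) (q t) c * q' t c) * q' t a
          + symD L (q t) a b * -pd V (q t) a) * q' t b
          + symD L (q t) a b * q' t a * -pd V (q t) b)
          = (∑ a, ∑ b, ∑ c, pd (fun q => symD L q a b) (q t) c * q' t c * q' t a * q' t b)
            - (∑ a, ∑ b, symD L (q t) a b * pd V (q t) a * q' t b)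
            - ∑ a, ∑ b, symD L (q t) a b * pd V (q t) b * q' t a := by
        simp only [← Finset.sum_sub_distrib]
        refine Finset.sum_congr rfl fun a _ => Finset.sum_congr rfl fun b _ => ?_
        simp only [← Finset.sum_mul]
        ring
      rw [this, cubic, swap]
      ring
    have eM : ∑ a, ((∑ c, pd (fun q => L q a) (q t) c * q' t c) * q' t a
          + L (q t) a * -pd V (q t) a)
        = (∑ a, ∑ b, symD L (q t) a b * q' t a * q' t b)
          - ∑ a, L (q t) a * pd V (q t) a := by
      rw [quad, ← Finset.sum_sub_distrib]
      exact Finset.sum_congr rfl fun a _ => by ring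
    have eP : ∑ a, pd (fun q => ∑ b, L q b * pd V q b) (q t) a * q' t a
        = -2 * (∑ a, ∑ b, symD L (q t) a b * pd V (q t) b * q' t a)
          - lam ^ 2 * ∑ a, L (q t) a * q' t a := by
      simp only [hLV, Finset.mul_sum, ← Finset.sum_sub_distrib]
      refine Finset.sum_congr rfl fun a _ => ?_
      rw [sub_mul, Finset.sum_mul]
      simp only [mul_assoc]
    simp only [Pi.add_apply, Pi.neg_apply, Pi.mul_apply]
    rw [eK, eM, eP]
    ring
  intro t₁ h₁ t₂ h₂
  exact isOpen_Ioo.is_const_of_deriv_eq_zero isPreconnected_Ioo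
    (fun t ht => (key t ht).differentiableAt.differentiableWithinAt)
    (fun t ht => (key t ht).deriv) h₁ h₂
end

section
/- (Classification of second-order Killing tensors of the Euclidean plane.) Let C : ℝ² → ℝ²ˣ² be a smooth symmetric-matrix-valued field, written with components C_{xx}, C_{xy} = C_{yx}, C_{yy}. Then C satisfies the flat Killing tensor equation ∂_c C_{ab} + ∂_a C_{bc} + ∂_b C_{ca} = 0 for all indices a,b,c ∈ {x,y} if and only if there exist real constants α, β, γ, A, B, C₀ such that C_{xx}(x,y) = γ y² + 2α y + A, C_{xy}(x,y) = −γ x y − α x − β y + C₀, and C_{yy}(x,y) = γ x² + 2β x + B. -/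
open Real
open scoped ContDiff

/-- The coordinate directions of the Euclidean plane. -/
def dir2 : Fin 2 → ℝ × ℝ := ![(1, 0), (0, 1)]

/-- Partial derivative of a scalar field on the plane in the `a`-th coordinate direction. -/
noncomputable def pd2 (f : ℝ × ℝ → ℝ) (p : ℝ × ℝ) (a : Fin 2) : ℝ :=
  fderiv ℝ f p (dir2 a)

theorem hasDerivAt_pd2_zero {f : ℝ × ℝ → ℝ} (hf : Differentiable ℝ f) (x y : ℝ) :
    HasDerivAt (fun t => f (t, y)) (pd2 f (x, y) 0) x := by
  have h := (hf (x, y)).hasFDerivAt.comp_hasDerivAt x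
    ((hasDerivAt_id x).prodMk (hasDerivAt_const x y))
  exact h

theorem hasDerivAt_pd2_one {f : ℝ × ℝ → ℝ} (hf : Differentiable ℝ f) (x y : ℝ) :
    HasDerivAt (fun t => f (x, t)) (pd2 f (x, y) 1) y := by
  have h := (hf (x, y)).hasFDerivAt.comp_hasDerivAt y
    ((hasDerivAt_const y x).prodMk (hasDerivAt_id y))
  exact h

theorem hasDerivAt_quadratic (r p q t : ℝ) :
    HasDerivAt (fun s => r + p * s + q * s ^ 2) (p + 2 * q * t) t := by
  refine (((hasDerivAt_id t).const_mul p |>.const_add r).add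
    ((hasDerivAt_pow 2 t).const_mul q)).congr_deriv ?_
  norm_num
  ring

theorem HasDerivAt.eq_of_eq_quadratic {g : ℝ → ℝ} {d r p q t : ℝ} (hd : HasDerivAt g d t)
    (hg : ∀ s, g s = r + p * s + q * s ^ 2) : d = p + 2 * q * t := by
  obtain rfl : g = fun s => r + p * s + q * s ^ 2 := funext hg
  exact hd.unique (hasDerivAt_quadratic r p q t)

/-- A function with affine derivative is quadratic. -/
theorem eq_quadratic_of_hasDerivAt {g : ℝ → ℝ} {p q : ℝ}
    (hg : ∀ t, HasDerivAt g (p + 2 * q * t) t) (t : ℝ) :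
    g t = g 0 + p * t + q * t ^ 2 := by
  have hd (s : ℝ) : HasDerivAt (fun u => g u - (g 0 + p * u + q * u ^ 2)) 0 s :=
    ((hg s).sub (hasDerivAt_quadratic (g 0) p q s)).congr_deriv (sub_self _)
  have h := is_const_of_deriv_eq_zero (fun s => (hd s).differentiableAt)
    (fun s => (hd s).deriv) t 0
  norm_num at h
  linarith

/-- Classification of second-order Killing tensors of the Euclidean plane: a smooth
symmetric field `C_{ab}` satisfies `∂_c C_{ab} + ∂_a C_{bc} + ∂_b C_{ca} = 0` for all
indices iff its components have the quadratic form `C_{xx} = γy² + 2αy + A`,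
`C_{xy} = −γxy − αx − βy + C₀`, `C_{yy} = γx² + 2βx + B` for some constants. -/
theorem stmt4 (C : ℝ × ℝ → Fin 2 → Fin 2 → ℝ)
    (hCsmooth : ∀ a b, ContDiff ℝ ∞ (fun p => C p a b))
    (hCsym : ∀ p a b, C p a b = C p b a) :
    (∀ p a b c,
      pd2 (fun p => C p a b) p c + pd2 (fun p => C p b c) p a
        + pd2 (fun p => C p c a) p b = 0)
    ↔
    ∃ α β γ A B C₀ : ℝ, ∀ x y : ℝ,
      C (x, y) 0 0 = γ * y^2 + 2 * α * y + A ∧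
      C (x, y) 0 1 = -(γ * x * y) - α * x - β * y + C₀ ∧
      C (x, y) 1 0 = -(γ * x * y) - α * x - β * y + C₀ ∧
      C (x, y) 1 1 = γ * x^2 + 2 * β * x + B := by
  have hdiff (a b : Fin 2) : Differentiable ℝ (fun p => C p a b) :=
    (hCsmooth a b).differentiable (by simp)
  have hx (a b : Fin 2) := hasDerivAt_pd2_zero (hdiff a b)
  have hy (a b : Fin 2) := hasDerivAt_pd2_one (hdiff a b)
  have hsym : (fun p => C p 1 0) = fun p => C p 0 1 := funext fun p => hCsym p 1 0
  constructor
  · intro h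
    have hxxx (p) : pd2 (fun p => C p 0 0) p 0 = 0 := by linarith [h p 0 0 0]
    have hyyy (p) : pd2 (fun p => C p 1 1) p 1 = 0 := by linarith [h p 1 1 1]
    have hxxy (p) : pd2 (fun p => C p 0 1) p 0 = -(pd2 (fun p => C p 0 0) p 1) / 2 := by
      have := h p 0 0 1
      rw [hsym] at this
      linarith
    have hxyy (p) : pd2 (fun p => C p 0 1) p 1 = -(pd2 (fun p => C p 1 1) p 0) / 2 := by
      have := h p 1 1 0
      rw [hsym] at this
      linarith
    have hxx (x y) : C (x, y) 0 0 = C (0, y) 0 0 := by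
      have := eq_quadratic_of_hasDerivAt (p := 0) (q := 0)
        (fun t => (hx 0 0 t y).congr_deriv (by simp [hxxx])) x
      simpa using this
    have hyy (x y) : C (x, y) 1 1 = C (x, 0) 1 1 := by
      have := eq_quadratic_of_hasDerivAt (p := 0) (q := 0)
        (fun t => (hy 1 1 x t).congr_deriv (by simp [hyyy])) y
      simpa using this
    obtain ⟨a', ha'⟩ : ∃ a' : ℝ → ℝ, ∀ x y, pd2 (fun p => C p 0 0) (x, y) 1 = a' y := by
      refine ⟨fun y => pd2 (fun p => C p 0 0) (0, y) 1, fun x y => ?_⟩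
      refine (hy 0 0 x y).unique ?_
      simpa only [hxx x] using hy 0 0 0 y
    obtain ⟨b', hb'⟩ : ∃ b' : ℝ → ℝ, ∀ x y, pd2 (fun p => C p 1 1) (x, y) 0 = b' x := by
      refine ⟨fun x => pd2 (fun p => C p 1 1) (x, 0) 0, fun x y => ?_⟩
      refine (hx 1 1 x y).unique ?_
      simpa only [hyy _ y] using hx 1 1 x 0
    have hxy_x (x y) : C (x, y) 0 1 = C (0, y) 0 1 - a' y / 2 * x := by
      have := eq_quadratic_of_hasDerivAt (p := -(a' y) / 2) (q := 0)
        (fun t => (hx 0 1 t y).congr_deriv (by simp [hxxy, ha'])) x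
      linarith
    have hxy_y (x y) : C (x, y) 0 1 = C (x, 0) 0 1 - b' x / 2 * y := by
      have := eq_quadratic_of_hasDerivAt (p := -(b' x) / 2) (q := 0)
        (fun t => (hy 0 1 x t).congr_deriv (by simp [hxyy, hb'])) y
      linarith
    have key (x y) : x * (a' y - a' 0) = y * (b' x - b' 0) := by
      linarith [hxy_x x y, hxy_y x y, hxy_y 0 y, hxy_x x 0]
    have ha (y) : a' y = a' 0 + (a' 1 - a' 0) * y := by
      linear_combination key 1 y - y * key 1 1
    have hb (x) : b' x = b' 0 + (a' 1 - a' 0) * x := by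
      linear_combination -key x 1
    have hxy (x y) : C (x, y) 0 1
        = -((a' 1 - a' 0) / 2 * x * y) - a' 0 / 2 * x - b' 0 / 2 * y + C (0, 0) 0 1 := by
      linear_combination hxy_x x y + hxy_y 0 y - x / 2 * ha y
    refine ⟨a' 0 / 2, b' 0 / 2, (a' 1 - a' 0) / 2, C (0, 0) 0 0, C (0, 0) 1 1, C (0, 0) 0 1,
      fun x y => ⟨?_, hxy x y, (hCsym _ 1 0).trans (hxy x y), ?_⟩⟩
    · have := eq_quadratic_of_hasDerivAt (p := a' 0) (q := (a' 1 - a' 0) / 2)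
        (fun t => (hy 0 0 0 t).congr_deriv (by rw [ha', ha t]; ring)) y
      rw [hxx, this]
      ring
    · have := eq_quadratic_of_hasDerivAt (p := b' 0) (q := (a' 1 - a' 0) / 2)
        (fun t => (hx 1 1 t 0).congr_deriv (by rw [hb', hb t]; ring)) x
      rw [hyy, this]
      ring
  · rintro ⟨α, β, γ, A, B, C₀, h⟩
    have hxxx (x y) : pd2 (fun p => C p 0 0) (x, y) 0 = 0 := by
      refine (hx 0 0 x y).unique ?_
      simpa only [(h _ _).1] using hasDerivAt_const x _
    have hyyy (x y) : pd2 (fun p => C p 1 1) (x, y) 1 = 0 := by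
      refine (hy 1 1 x y).unique ?_
      simpa only [(h _ _).2.2.2] using hasDerivAt_const y _
    have hxxy (x y) : pd2 (fun p => C p 0 0) (x, y) 1 = 2 * α + 2 * γ * y :=
      (hy 0 0 x y).eq_of_eq_quadratic (r := A) fun t => by linear_combination (h x t).1
    have hyyx (x y) : pd2 (fun p => C p 1 1) (x, y) 0 = 2 * β + 2 * γ * x :=
      (hx 1 1 x y).eq_of_eq_quadratic (r := B) fun t => by linear_combination (h t y).2.2.2
    have hxyx (x y) : pd2 (fun p => C p 0 1) (x, y) 0 = -α - γ * y := by
      have := (hx 0 1 x y).eq_of_eq_quadratic (r := C₀ - β * y) (p := -α - γ * y) (q := 0)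
        fun t => by linear_combination (h t y).2.1
      linarith
    have hxyy (x y) : pd2 (fun p => C p 0 1) (x, y) 1 = -β - γ * x := by
      have := (hy 0 1 x y).eq_of_eq_quadratic (r := C₀ - α * x) (p := -β - γ * x) (q := 0)
        fun t => by linear_combination (h x t).2.1
      linarith
    rintro ⟨x, y⟩ a b c
    fin_cases a <;> fin_cases b <;> fin_cases c <;>
      simp only [Fin.zero_eta, Fin.mk_one, hsym, hxxx, hyyy, hxxy, hyyx, hxyx, hxyy] <;> ring
end

section
/- (Bertrand–Darboux equation.) Let V : U → ℝ be smooth on an open set U ⊆ ℝ², let α, β, γ, A, B, C₀ be real constants, and let C_{ab} be the Killing tensor with components C_{xx} = γ y² + 2α y + A, C_{xy} = −γ x y − α x − β y + C₀, C_{yy} = γ x² + 2β x + B. If there exists a smooth function G : U → ℝ satisfying ∂_x G = 2(C_{xx} V_x + C_{xy} V_y) and ∂_y G = 2(C_{xy} V_x + C_{yy} V_y) on U, then V satisfies on U the second-order Bertrand–Darboux PDE: (γ x y + α x + β y − C₀)(V_{xx} − V_{yy}) + [γ(y² − x²) − 2β x + 2α y + A − B] V_{xy} − 3(γ x + β) V_y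 + 3(γ y + α) V_x = 0, where subscripts on V denote partial derivatives. -/
open Real
open scoped ContDiff

noncomputable def pX (V : ℝ × ℝ → ℝ) (p : ℝ × ℝ) : ℝ := fderiv ℝ V p (1, 0)
noncomputable def pY (V : ℝ × ℝ → ℝ) (p : ℝ × ℝ) : ℝ := fderiv ℝ V p (0, 1)
noncomputable def pXX (V : ℝ × ℝ → ℝ) (p : ℝ × ℝ) : ℝ := fderiv ℝ (pX V) p (1, 0)
noncomputable def pXY (V : ℝ × ℝ → ℝ) (p : ℝ × ℝ) : ℝ := fderiv ℝ (pX V) p (0, 1)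
noncomputable def pYY (V : ℝ × ℝ → ℝ) (p : ℝ × ℝ) : ℝ := fderiv ℝ (pY V) p (0, 1)

/-- Second directional derivatives of a `C²` function commute. -/
theorem fderiv_fderiv_apply_comm {E : Type*} [NormedAddCommGroup E] [NormedSpace ℝ E]
    {f : E → ℝ} {p : E} (hf : ContDiffAt ℝ 2 f p) (v w : E) :
    fderiv ℝ (fun q => fderiv ℝ f q v) p w = fderiv ℝ (fun q => fderiv ℝ f q w) p v := by
  have hd : DifferentiableAt ℝ (fderiv ℝ f) p :=
    (hf.fderiv_right (m := 1) (by norm_num)).differentiableAt (by norm_num)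
  have key (x y : E) : fderiv ℝ (fun q => fderiv ℝ f q x) p y = fderiv ℝ (fderiv ℝ f) p y x := by
    rw [fderiv_clm_apply hd (differentiableAt_const x)]
    simp
  rw [key, key]
  exact hf.isSymmSndFDerivAt (by simp) w v

theorem differentiableAt_fderiv_apply {E : Type*} [NormedAddCommGroup E] [NormedSpace ℝ E]
    {f : E → ℝ} {p : E} (hf : ContDiffAt ℝ 2 f p) (v : E) :
    DifferentiableAt ℝ (fun q => fderiv ℝ f q v) p :=
  ((hf.fderiv_right (m := 1) (by norm_num)).differentiableAt (by norm_num)).clm_apply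
    (differentiableAt_const v)

theorem fderiv_two_mul_add_apply {E : Type*} [NormedAddCommGroup E] [NormedSpace ℝ E]
    {F a b u v : E → ℝ} {p : E} (ha : DifferentiableAt ℝ a p) (hb : DifferentiableAt ℝ b p)
    (hu : DifferentiableAt ℝ u p) (hv : DifferentiableAt ℝ v p)
    (hF : F =ᶠ[nhds p] fun q => 2 * (a q * u q + b q * v q)) (w : E) :
    fderiv ℝ F p w = 2 * (a p * fderiv ℝ u p w + u p * fderiv ℝ a p w
      + (b p * fderiv ℝ v p w + v p * fderiv ℝ b p w)) := by
  have h := ((ha.hasFDerivAt.mul hu.hasFDerivAt).add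
    (hb.hasFDerivAt.mul hv.hasFDerivAt)).const_mul 2
  rw [(h.congr_of_eventuallyEq hF).fderiv]
  simp
  ring

/-- The Fréchet derivative of a quadratic polynomial on the plane. -/
theorem hasFDerivAt_quadratic (a b c d e k : ℝ) (p : ℝ × ℝ) :
    HasFDerivAt (fun q : ℝ × ℝ => a * q.1 ^ 2 + b * q.1 * q.2 + c * q.2 ^ 2 + d * q.1 + e * q.2 + k)
      ((2 * a * p.1 + b * p.2 + d) • ContinuousLinearMap.fst ℝ ℝ ℝ
        + (b * p.1 + 2 * c * p.2 + e) • ContinuousLinearMap.snd ℝ ℝ ℝ) p := by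
  have h1 : HasFDerivAt (fun q : ℝ × ℝ => q.1) (ContinuousLinearMap.fst ℝ ℝ ℝ) p := hasFDerivAt_fst
  have h2 : HasFDerivAt (fun q : ℝ × ℝ => q.2) (ContinuousLinearMap.snd ℝ ℝ ℝ) p := hasFDerivAt_snd
  refine ((((((h1.pow 2).const_mul a).add ((h1.const_mul b).mul h2)).add
    ((h2.pow 2).const_mul c)).add (h1.const_mul d)).add (h2.const_mul e)).add_const k
    |>.congr_fderiv ?_
  ext <;> simp <;> ring

/-- Bertrand–Darboux equation: if for the Killing tensor with components
`C_{xx} = γy² + 2αy + A`, `C_{xy} = −γxy − αx − βy + C₀`, `C_{yy} = γx² + 2βx + B`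
there is a smooth `G` on an open set `U` with `∂_xG = 2(C_{xx}V_x + C_{xy}V_y)` and
`∂_yG = 2(C_{xy}V_x + C_{yy}V_y)`, then `V` satisfies on `U` the Bertrand–Darboux PDE. -/
theorem stmt6 (U : Set (ℝ × ℝ)) (hU : IsOpen U)
    (V : ℝ × ℝ → ℝ) (hV : ContDiffOn ℝ ∞ V U)
    (α β γ A B C₀ : ℝ)
    (G : ℝ × ℝ → ℝ) (hGsmooth : ContDiffOn ℝ ∞ G U)
    (hGx : ∀ p ∈ U, pX G p
      = 2 * ((γ * p.2^2 + 2 * α * p.2 + A) * pX V p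
           + (-(γ * p.1 * p.2) - α * p.1 - β * p.2 + C₀) * pY V p))
    (hGy : ∀ p ∈ U, pY G p
      = 2 * ((-(γ * p.1 * p.2) - α * p.1 - β * p.2 + C₀) * pX V p
           + (γ * p.1^2 + 2 * β * p.1 + B) * pY V p)) :
    ∀ p ∈ U,
      (γ * p.1 * p.2 + α * p.1 + β * p.2 - C₀) * (pXX V p - pYY V p)
        + (γ * (p.2^2 - p.1^2) - 2 * β * p.1 + 2 * α * p.2 + A - B) * pXY V p
        - 3 * (γ * p.1 + β) * pY V p + 3 * (γ * p.2 + α) * pX V p = 0 := by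
  intro p hp
  have hUp : U ∈ nhds p := hU.mem_nhds hp
  have h2 : (2 : WithTop ℕ∞) ≤ ∞ := WithTop.coe_le_coe.2 le_top
  have hVp : ContDiffAt ℝ 2 V p := (hV.contDiffAt hUp).of_le h2
  have hGp : ContDiffAt ℝ 2 G p := (hGsmooth.contDiffAt hUp).of_le h2
  have hX : DifferentiableAt ℝ (pX V) p := differentiableAt_fderiv_apply hVp (1, 0)
  have hY : DifferentiableAt ℝ (pY V) p := differentiableAt_fderiv_apply hVp (0, 1)
  have hVsymm : fderiv ℝ (pY V) p (1, 0) = fderiv ℝ (pX V) p (0, 1) :=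
    fderiv_fderiv_apply_comm hVp (0, 1) (1, 0)
  have hGsymm : fderiv ℝ (pY G) p (1, 0) = fderiv ℝ (pX G) p (0, 1) :=
    fderiv_fderiv_apply_comm hGp (0, 1) (1, 0)
  have hxx := hasFDerivAt_quadratic 0 0 γ 0 (2 * α) A p
  have hxy := hasFDerivAt_quadratic 0 (-γ) 0 (-α) (-β) C₀ p
  have hyy := hasFDerivAt_quadratic γ 0 0 (2 * β) 0 B p
  have hGxy := fderiv_two_mul_add_apply hxx.differentiableAt hxy.differentiableAt hX hY
    (F := pX G) (by filter_upwards [hUp] with q hq; rw [hGx q hq]; ring) (0, 1)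
  have hGyx := fderiv_two_mul_add_apply hxy.differentiableAt hyy.differentiableAt hX hY
    (F := pY G) (by filter_upwards [hUp] with q hq; rw [hGy q hq]; ring) (1, 0)
  rw [hGsymm, hGxy, hVsymm, hxx.fderiv, hxy.fderiv, hyy.fderiv] at hGyx
  simp at hGyx
  unfold pXX pXY pYY
  linear_combination hGyx
end

section
/- (Class I potential V₁ = c x + F(y − b x).) Let b, c be real constants and F : ℝ → ℝ a C² function, and set V(x,y) = c x + F(y − b x). Along every C² solution (x(t), y(t)) of ẍ = −V_x, ÿ = −V_y, the quantities L₂₁ = ẋ + b ẏ + c t, L₂₂ = t(ẋ + b ẏ) − (x + b y) + (c/2) t², and Q₂₁ = (ẋ + b ẏ)² + 2c(x + b y) are each constant in t. -/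
open Real

/-- The potential has constant derivative in the direction `(1, b)`: `∂ₓV + b ∂_yV = c`. -/
theorem pX_add_mul_pY (b c : ℝ) {F : ℝ → ℝ} (hF : Differentiable ℝ F) (p : ℝ × ℝ) :
    pX (fun p : ℝ × ℝ => c * p.1 + F (p.2 - b * p.1)) p +
      b * pY (fun p : ℝ × ℝ => c * p.1 + F (p.2 - b * p.1)) p = c := by
  have h₁ : HasFDerivAt (fun p : ℝ × ℝ => p.1) (ContinuousLinearMap.fst ℝ ℝ ℝ) p :=
    hasFDerivAt_fst
  have h₂ : HasFDerivAt (fun p : ℝ × ℝ => p.2) (ContinuousLinearMap.snd ℝ ℝ ℝ) p :=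
    hasFDerivAt_snd
  have hV := (h₁.const_mul c).add
    ((hF (p.2 - b * p.1)).hasDerivAt.comp_hasFDerivAt p (h₂.sub (h₁.const_mul b)))
  have hV' : HasFDerivAt (fun p : ℝ × ℝ => c * p.1 + F (p.2 - b * p.1)) _ p := hV
  simp only [pX, pY, hV'.fderiv]
  simp
  ring

theorem eq_of_hasDerivAt_zero {f : ℝ → ℝ} (hf : ∀ t, HasDerivAt f 0 t) (t₁ t₂ : ℝ) :
    f t₁ = f t₂ :=
  is_const_of_deriv_eq_zero (fun t => (hf t).differentiableAt) (fun t => (hf t).deriv) t₁ t₂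

/-- Class I potential `V₁ = c x + F(y − b x)`: the quantities `L₂₁`, `L₂₂`, `Q₂₁`
are constant along every C² solution. -/
theorem stmt8 (b c : ℝ) (F : ℝ → ℝ) (hF : ContDiff ℝ 2 F)
    (x y x' y' : ℝ → ℝ)
    (hx : ∀ t, HasDerivAt x (x' t) t) (hy : ∀ t, HasDerivAt y (y' t) t)
    (hx' : ∀ t, HasDerivAt x'
      (-(pX (fun p : ℝ × ℝ => c * p.1 + F (p.2 - b * p.1)) (x t, y t))) t)
    (hy' : ∀ t, HasDerivAt y'
      (-(pY (fun p : ℝ × ℝ => c * p.1 + F (p.2 - b * p.1)) (x t, y t))) t) :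
    (∀ t₁ t₂, x' t₁ + b * y' t₁ + c * t₁ = x' t₂ + b * y' t₂ + c * t₂) ∧
    (∀ t₁ t₂, t₁ * (x' t₁ + b * y' t₁) - (x t₁ + b * y t₁) + (c / 2) * t₁^2
            = t₂ * (x' t₂ + b * y' t₂) - (x t₂ + b * y t₂) + (c / 2) * t₂^2) ∧
    (∀ t₁ t₂, (x' t₁ + b * y' t₁)^2 + 2 * c * (x t₁ + b * y t₁)
            = (x' t₂ + b * y' t₂)^2 + 2 * c * (x t₂ + b * y t₂)) := by
  have hz : ∀ t, HasDerivAt (fun s => x s + b * y s) (x' t + b * y' t) t := fun t =>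
    (hx t).add ((hy t).const_mul b)
  have hz' : ∀ t, HasDerivAt (fun s => x' s + b * y' s) (-c) t := fun t => by
    refine ((hx' t).add ((hy' t).const_mul b)).congr_deriv ?_
    linear_combination -pX_add_mul_pY b c (hF.differentiable (by norm_num)) (x t, y t)
  refine ⟨eq_of_hasDerivAt_zero (f := fun t => x' t + b * y' t + c * t) fun t => ?_,
    eq_of_hasDerivAt_zero
      (f := fun t => t * (x' t + b * y' t) - (x t + b * y t) + (c / 2) * t ^ 2) fun t => ?_,
    eq_of_hasDerivAt_zero
      (f := fun t => (x' t + b * y' t) ^ 2 + 2 * c * (x t + b * y t)) fun t => ?_⟩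
  · refine ((hz' t).add ((hasDerivAt_id t).const_mul c)).congr_deriv ?_
    ring
  · refine ((((hasDerivAt_id t).mul (hz' t)).sub (hz t)).add
      (((hasDerivAt_id t).pow 2).const_mul (c / 2))).congr_deriv ?_
    simp only [id]
    push_cast
    ring
  · refine (((hz' t).pow 2).add ((hz t).const_mul (2 * c))).congr_deriv ?_
    push_cast
    ring
end

section
/- (Ermakov–Lewis invariant.) Let F₁ : ℝ → ℝ and F₂ : (0,∞) → ℝ be C¹ functions and, on the open set {(x,y) : x ≠ 0}, set V(x,y) = F₁(y/x)/(x² + y²) + F₂(x² + y²). Along every C² solution (x(t), y(t)) of ẍ = −V_x, ÿ = −V_y remaining in this set, the quantity I₁₁ = (y ẋ − x ẏ)² + 2 F₁(y/x) is constant in t. -/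
open Real

/-- The angular derivative of `F₁(y/x)/(x²+y²) + F₂(x²+y²)` is `F₁'(y/x)/x²`. -/
theorem angular_deriv_potential {F₁ F₂ : ℝ → ℝ} {a b : ℝ} (ha : a ≠ 0)
    (hF₁ : DifferentiableAt ℝ F₁ (b / a)) (hF₂ : DifferentiableAt ℝ F₂ (a ^ 2 + b ^ 2)) :
    a * pY (fun p : ℝ × ℝ => F₁ (p.2 / p.1) / (p.1^2 + p.2^2) + F₂ (p.1^2 + p.2^2)) (a, b)
      - b * pX (fun p : ℝ × ℝ => F₁ (p.2 / p.1) / (p.1^2 + p.2^2)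
        + F₂ (p.1^2 + p.2^2)) (a, b) = deriv F₁ (b / a) / a ^ 2 := by
  rw [div_eq_mul_inv] at hF₁
  have hr : a ^ 2 + b ^ 2 ≠ 0 := by positivity
  have h₁ : HasFDerivAt (fun p : ℝ × ℝ => p.1) (ContinuousLinearMap.fst ℝ ℝ ℝ) (a, b) :=
    hasFDerivAt_fst
  have h₂ : HasFDerivAt (fun p : ℝ × ℝ => p.2) (ContinuousLinearMap.snd ℝ ℝ ℝ) (a, b) :=
    hasFDerivAt_snd
  have hq := (h₁.pow 2).add (h₂.pow 2)
  have hslope := h₂.mul ((hasDerivAt_inv ha).comp_hasFDerivAt (a, b) h₁)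
  have hf := HasDerivAt.comp_hasFDerivAt (a, b) (h₂ := F₁) (f := fun p : ℝ × ℝ => p.2 * p.1⁻¹)
    hF₁.hasDerivAt hslope
  have hg := HasDerivAt.comp_hasFDerivAt (a, b) (h₂ := F₂)
    (f := fun p : ℝ × ℝ => p.1 ^ 2 + p.2 ^ 2) hF₂.hasDerivAt hq
  have hinv := HasDerivAt.comp_hasFDerivAt (a, b) (h₂ := fun r : ℝ => r⁻¹)
    (f := fun p : ℝ × ℝ => p.1 ^ 2 + p.2 ^ 2) (hasDerivAt_inv hr) hq
  have hV := (hf.mul hinv).add hg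
  have hV' := hV.congr_of_eventuallyEq (f₁ := fun p : ℝ × ℝ => F₁ (p.2 / p.1) / (p.1^2 + p.2^2)
      + F₂ (p.1^2 + p.2^2)) (.of_forall fun p => by simp [div_eq_mul_inv])
  rw [pX, pY, hV'.fderiv]
  simp [div_eq_mul_inv]
  field_simp
  ring

/-- Ermakov–Lewis invariant: for `V = F₁(y/x)/(x²+y²) + F₂(x²+y²)` on `{x ≠ 0}`,
the quantity `I₁₁ = (yẋ − xẏ)² + 2F₁(y/x)` is constant along solutions
remaining in this set. -/
theorem stmt14 (F₁ F₂ : ℝ → ℝ) (hF₁ : ContDiff ℝ 1 F₁)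
    (hF₂ : ContDiffOn ℝ 1 F₂ (Set.Ioi 0))
    (x y x' y' : ℝ → ℝ) (hdom : ∀ t, x t ≠ 0)
    (hx : ∀ t, HasDerivAt x (x' t) t) (hy : ∀ t, HasDerivAt y (y' t) t)
    (hx' : ∀ t, HasDerivAt x'
      (-(pX (fun p : ℝ × ℝ => F₁ (p.2 / p.1) / (p.1^2 + p.2^2)
        + F₂ (p.1^2 + p.2^2)) (x t, y t))) t)
    (hy' : ∀ t, HasDerivAt y'
      (-(pY (fun p : ℝ × ℝ => F₁ (p.2 / p.1) / (p.1^2 + p.2^2)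
        + F₂ (p.1^2 + p.2^2)) (x t, y t))) t) :
    ∀ t₁ t₂, (y t₁ * x' t₁ - x t₁ * y' t₁)^2 + 2 * F₁ (y t₁ / x t₁)
           = (y t₂ * x' t₂ - x t₂ * y' t₂)^2 + 2 * F₁ (y t₂ / x t₂) := by
  have hI : ∀ t, HasDerivAt
      (fun t => (y t * x' t - x t * y' t) ^ 2 + 2 * F₁ (y t / x t)) 0 t := by
    intro t
    have hxt := hdom t
    have hpos : 0 < x t ^ 2 + y t ^ 2 := by positivity
    have hd₁ : DifferentiableAt ℝ F₁ (y t / x t) := hF₁.differentiable one_ne_zero _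
    have hd₂ : DifferentiableAt ℝ F₂ (x t ^ 2 + y t ^ 2) :=
      (hF₂.differentiableOn one_ne_zero).differentiableAt (Ioi_mem_nhds hpos)
    have hang := angular_deriv_potential hxt hd₁ hd₂
    have hL := ((hy t).mul (hx' t)).sub ((hx t).mul (hy' t))
    have hF := hd₁.hasDerivAt.comp t ((hy t).div (hx t) hxt)
    refine ((hL.pow 2).add (hF.const_mul 2)).congr_deriv ?_
    simp only [Pi.mul_apply, Pi.sub_apply]
    linear_combination (2 * (y t * x' t - x t * y' t)) * hang
  exact is_const_of_deriv_eq_zero (fun t => (hI t).differentiableAt) fun t => (hI t).deriv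
end

section
/- (New integrable potential V₂₁a.) Let k, ℓ be real constants with ℓ > 0 and let F₂ : (0,∞) → ℝ be C¹. On the open set {(x,y) : x² + ℓ y² ≠ 0}, set V(x,y) = k/(x² + ℓ y²) + F₂(x² + y²). Along every C² solution (x(t), y(t)) of ẍ = −V_x, ÿ = −V_y remaining in this set, the quantity I₁₁a = (y ẋ − x ẏ)² + 2k(1 − ℓ) y²/(x² + ℓ y²) is constant in t. -/
open Real

/-- The Fréchet derivative of the potential `k/(x² + ℓy²) + F(x² + y²)`. -/
theorem hasFDerivAt_potential {k ℓ : ℝ} {F : ℝ → ℝ} {a b : ℝ} (hQ : a ^ 2 + ℓ * b ^ 2 ≠ 0)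
    (hF : DifferentiableAt ℝ F (a ^ 2 + b ^ 2)) :
    HasFDerivAt (fun p : ℝ × ℝ => k / (p.1 ^ 2 + ℓ * p.2 ^ 2) + F (p.1 ^ 2 + p.2 ^ 2))
      ((2 * a * (deriv F (a ^ 2 + b ^ 2) - k / (a ^ 2 + ℓ * b ^ 2) ^ 2)) •
          ContinuousLinearMap.fst ℝ ℝ ℝ +
        (2 * b * (deriv F (a ^ 2 + b ^ 2) - k * ℓ / (a ^ 2 + ℓ * b ^ 2) ^ 2)) •
          ContinuousLinearMap.snd ℝ ℝ ℝ) (a, b) := by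
  have h₁ : HasFDerivAt (fun p : ℝ × ℝ => p.1) (ContinuousLinearMap.fst ℝ ℝ ℝ) (a, b) :=
    hasFDerivAt_fst
  have h₂ : HasFDerivAt (fun p : ℝ × ℝ => p.2) (ContinuousLinearMap.snd ℝ ℝ ℝ) (a, b) :=
    hasFDerivAt_snd
  have hk : HasDerivAt (fun q : ℝ => k / q) (-k / (a ^ 2 + ℓ * b ^ 2) ^ 2)
      (a ^ 2 + ℓ * b ^ 2) := by
    simpa using (hasDerivAt_const (a ^ 2 + ℓ * b ^ 2) k).fun_div (hasDerivAt_id' _) hQ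
  have hq := hk.comp_hasFDerivAt (a, b) ((h₁.pow 2).add ((h₂.pow 2).const_mul ℓ))
  have hr := hF.hasDerivAt.comp_hasFDerivAt (a, b) ((h₁.pow 2).add (h₂.pow 2))
  refine (hq.add hr).congr_fderiv ?_
  ext <;> simp <;> ring

/-- New integrable potential `V₂₁a = k/(x² + ℓy²) + F₂(x² + y²)` on the set
`x² + ℓy² ≠ 0`: the quantity `I₁₁a = (yẋ − xẏ)² + 2k(1 − ℓ)y²/(x² + ℓy²)` is
constant along solutions remaining in this set. -/
theorem stmt15 (k ℓ : ℝ) (hℓ : 0 < ℓ) (F₂ : ℝ → ℝ)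
    (hF₂ : ContDiffOn ℝ 1 F₂ (Set.Ioi 0))
    (x y x' y' : ℝ → ℝ) (hdom : ∀ t, (x t)^2 + ℓ * (y t)^2 ≠ 0)
    (hx : ∀ t, HasDerivAt x (x' t) t) (hy : ∀ t, HasDerivAt y (y' t) t)
    (hx' : ∀ t, HasDerivAt x'
      (-(pX (fun p : ℝ × ℝ => k / (p.1^2 + ℓ * p.2^2) + F₂ (p.1^2 + p.2^2)) (x t, y t))) t)
    (hy' : ∀ t, HasDerivAt y'
      (-(pY (fun p : ℝ × ℝ => k / (p.1^2 + ℓ * p.2^2) + F₂ (p.1^2 + p.2^2)) (x t, y t))) t) :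
    ∀ t₁ t₂, (y t₁ * x' t₁ - x t₁ * y' t₁)^2
               + 2 * k * (1 - ℓ) * (y t₁)^2 / ((x t₁)^2 + ℓ * (y t₁)^2)
           = (y t₂ * x' t₂ - x t₂ * y' t₂)^2
               + 2 * k * (1 - ℓ) * (y t₂)^2 / ((x t₂)^2 + ℓ * (y t₂)^2) := by
  have hpos (t : ℝ) : 0 < x t ^ 2 + y t ^ 2 := by
    refine lt_of_le_of_ne (by positivity) fun h => hdom t ?_
    have hx0 : x t ^ 2 = 0 := by nlinarith [sq_nonneg (x t), sq_nonneg (y t)]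
    have hy0 : y t ^ 2 = 0 := by nlinarith [sq_nonneg (x t), sq_nonneg (y t)]
    rw [hx0, hy0, mul_zero, add_zero]
  have hV (t : ℝ) := hasFDerivAt_potential (k := k) (hdom t)
    ((hF₂.differentiableOn one_ne_zero).differentiableAt (Ioi_mem_nhds (hpos t)))
  have hI (t : ℝ) : HasDerivAt (fun t => (y t * x' t - x t * y' t) ^ 2
      + 2 * k * (1 - ℓ) * (y t) ^ 2 / ((x t) ^ 2 + ℓ * (y t) ^ 2)) 0 t := by
    have hax := hx' t
    have hay := hy' t
    rw [pX, (hV t).fderiv] at hax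
    rw [pY, (hV t).fderiv] at hay
    have hL := (((hy t).fun_mul hax).fun_sub ((hx t).fun_mul hay)).fun_pow 2
    have hR := (((hy t).fun_pow 2).const_mul (2 * k * (1 - ℓ))).fun_div
      (((hx t).fun_pow 2).fun_add (((hy t).fun_pow 2).const_mul ℓ)) (hdom t)
    refine (hL.fun_add hR).congr_deriv ?_
    have hQ := hdom t
    simp
    field_simp
    ring
  exact is_const_of_deriv_eq_zero (fun t => (hI t).differentiableAt) fun t => (hI t).deriv
end

section
/- (Parabolic-type integrable potential V₂₄.) Let F₁, F₂ : (0,∞) → ℝ be C¹ functions and, on ℝ² \ {0} with r = √(x² + y²), set V(x,y) = (F₁(r + y) + F₂(r − y))/r, restricted to the open set where r + y > 0 and r − y > 0. Along every C² solution (x(t), y(t)) of ẍ = −V_x, ÿ = −V_y remaining in this set, the quantity I₄₁ = ẋ(y ẋ − x ẏ) + ((r + y) F₂(r − y) − (r − y) F₁(r + y))/r is constant in t. -/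
theorem hasDerivAt_of_contDiffOn_Ioi {F : ℝ → ℝ} (hF : ContDiffOn ℝ 1 F (Set.Ioi 0)) {u : ℝ}
    (hu : 0 < u) : HasDerivAt F (deriv F u) u :=
  ((hF.differentiableOn one_ne_zero).differentiableAt (Ioi_mem_nhds hu)).hasDerivAt

/-- The Fréchet derivative of `V₂₄` applied to a vector, for given derivatives `f₁`, `f₂`. -/
theorem fderiv_parabolic_potential {F₁ F₂ : ℝ → ℝ} {a b f₁ f₂ : ℝ} (hr : 0 < a ^ 2 + b ^ 2)
    (h₁ : HasDerivAt F₁ f₁ (√(a ^ 2 + b ^ 2) + b)) (h₂ : HasDerivAt F₂ f₂ (√(a ^ 2 + b ^ 2) - b))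
    (v : ℝ × ℝ) :
    fderiv ℝ (fun p : ℝ × ℝ => (F₁ (√(p.1 ^ 2 + p.2 ^ 2) + p.2)
        + F₂ (√(p.1 ^ 2 + p.2 ^ 2) - p.2)) / √(p.1 ^ 2 + p.2 ^ 2)) (a, b) v
      = (f₁ * ((a * v.1 + b * v.2) / √(a ^ 2 + b ^ 2) + v.2)
          + f₂ * ((a * v.1 + b * v.2) / √(a ^ 2 + b ^ 2) - v.2)) / √(a ^ 2 + b ^ 2)
        - (F₁ (√(a ^ 2 + b ^ 2) + b) + F₂ (√(a ^ 2 + b ^ 2) - b))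
          * (a * v.1 + b * v.2) / √(a ^ 2 + b ^ 2) ^ 3 := by
  have hr0 : √(a ^ 2 + b ^ 2) ≠ 0 := (Real.sqrt_pos.2 hr).ne'
  have hfst : HasFDerivAt (fun p : ℝ × ℝ => p.1) (ContinuousLinearMap.fst ℝ ℝ ℝ) (a, b) :=
    hasFDerivAt_fst
  have hsnd : HasFDerivAt (fun p : ℝ × ℝ => p.2) (ContinuousLinearMap.snd ℝ ℝ ℝ) (a, b) :=
    hasFDerivAt_snd
  have hq : HasFDerivAt (fun p : ℝ × ℝ => p.1 ^ 2 + p.2 ^ 2) _ (a, b) :=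
    (hfst.pow 2).add (hsnd.pow 2)
  have hs := hq.sqrt hr.ne'
  have h1 := HasDerivAt.comp_hasFDerivAt (a, b) h₁ (hs.add hsnd)
  have h2 := HasDerivAt.comp_hasFDerivAt (a, b) h₂ (hs.sub hsnd)
  have h := (h1.add h2).mul (HasDerivAt.comp_hasFDerivAt (a, b) (hasDerivAt_inv hr0) hs)
  have h' : HasFDerivAt (fun p : ℝ × ℝ => (F₁ (√(p.1 ^ 2 + p.2 ^ 2) + p.2)
        + F₂ (√(p.1 ^ 2 + p.2 ^ 2) - p.2)) / √(p.1 ^ 2 + p.2 ^ 2)) _ (a, b) := h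
  rw [h'.fderiv]
  simp
  field_simp
  ring


open Real

/-- Parabolic-type integrable potential `V₂₄ = (F₁(r+y) + F₂(r−y))/r`, with
`r = √(x²+y²)`, on the set where `r + y > 0` and `r − y > 0`: the quantity
`I₄₁ = ẋ(yẋ − xẏ) + ((r+y)F₂(r−y) − (r−y)F₁(r+y))/r` is constant along
solutions remaining in this set. -/
theorem stmt16 (F₁ F₂ : ℝ → ℝ)
    (hF₁ : ContDiffOn ℝ 1 F₁ (Set.Ioi 0)) (hF₂ : ContDiffOn ℝ 1 F₂ (Set.Ioi 0))
    (x y x' y' : ℝ → ℝ)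
    (hdom : ∀ t, 0 < Real.sqrt ((x t)^2 + (y t)^2) + y t
               ∧ 0 < Real.sqrt ((x t)^2 + (y t)^2) - y t)
    (hx : ∀ t, HasDerivAt x (x' t) t) (hy : ∀ t, HasDerivAt y (y' t) t)
    (hx' : ∀ t, HasDerivAt x'
      (-(pX (fun p : ℝ × ℝ => (F₁ (Real.sqrt (p.1^2 + p.2^2) + p.2)
          + F₂ (Real.sqrt (p.1^2 + p.2^2) - p.2)) / Real.sqrt (p.1^2 + p.2^2)) (x t, y t))) t)
    (hy' : ∀ t, HasDerivAt y'
      (-(pY (fun p : ℝ × ℝ => (F₁ (Real.sqrt (p.1^2 + p.2^2) + p.2)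
          + F₂ (Real.sqrt (p.1^2 + p.2^2) - p.2)) / Real.sqrt (p.1^2 + p.2^2)) (x t, y t))) t) :
    ∀ t₁ t₂,
      x' t₁ * (y t₁ * x' t₁ - x t₁ * y' t₁)
        + ((Real.sqrt ((x t₁)^2 + (y t₁)^2) + y t₁) * F₂ (Real.sqrt ((x t₁)^2 + (y t₁)^2) - y t₁)
           - (Real.sqrt ((x t₁)^2 + (y t₁)^2) - y t₁) * F₁ (Real.sqrt ((x t₁)^2 + (y t₁)^2) + y t₁))
          / Real.sqrt ((x t₁)^2 + (y t₁)^2)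
      = x' t₂ * (y t₂ * x' t₂ - x t₂ * y' t₂)
        + ((Real.sqrt ((x t₂)^2 + (y t₂)^2) + y t₂) * F₂ (Real.sqrt ((x t₂)^2 + (y t₂)^2) - y t₂)
           - (Real.sqrt ((x t₂)^2 + (y t₂)^2) - y t₂) * F₁ (Real.sqrt ((x t₂)^2 + (y t₂)^2) + y t₂))
          / Real.sqrt ((x t₂)^2 + (y t₂)^2) := by
  have hder (t : ℝ) : HasDerivAt (fun t => x' t * (y t * x' t - x t * y' t)
      + ((√(x t ^ 2 + y t ^ 2) + y t) * F₂ (√(x t ^ 2 + y t ^ 2) - y t)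
          - (√(x t ^ 2 + y t ^ 2) - y t) * F₁ (√(x t ^ 2 + y t ^ 2) + y t))
        / √(x t ^ 2 + y t ^ 2)) 0 t := by
    obtain ⟨hu, hv⟩ := hdom t
    have hr : 0 < √(x t ^ 2 + y t ^ 2) := by linarith
    have hq : 0 < x t ^ 2 + y t ^ 2 := Real.sqrt_pos.1 hr
    have hsq : √(x t ^ 2 + y t ^ 2) ^ 2 = x t ^ 2 + y t ^ 2 := Real.sq_sqrt hq.le
    have h₁ := hasDerivAt_of_contDiffOn_Ioi hF₁ hu
    have h₂ := hasDerivAt_of_contDiffOn_Ioi hF₂ hv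
    have hxt := hx' t
    have hyt := hy' t
    rw [pX, fderiv_parabolic_potential hq h₁ h₂] at hxt
    rw [pY, fderiv_parabolic_potential hq h₁ h₂] at hyt
    have hs : HasDerivAt (fun t => √(x t ^ 2 + y t ^ 2)) _ t :=
      (((hx t).pow 2).add ((hy t).pow 2)).sqrt hq.ne'
    have hU := hs.add (hy t)
    have hV := hs.sub (hy t)
    have hK := hxt.mul (((hy t).mul hxt).sub ((hx t).mul hyt))
    have hW := ((hU.mul (h₂.comp t hV)).sub (hV.mul (h₁.comp t hU))).div hs hr.ne'
    refine (hK.add hW).congr_deriv ?_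
    simp only [Pi.add_apply, Pi.sub_apply, Pi.mul_apply, Pi.pow_apply, Function.comp_apply]
    generalize F₁ (√(x t ^ 2 + y t ^ 2) + y t) = A
    generalize F₂ (√(x t ^ 2 + y t ^ 2) - y t) = B
    generalize deriv F₁ (√(x t ^ 2 + y t ^ 2) + y t) = C
    generalize deriv F₂ (√(x t ^ 2 + y t ^ 2) - y t) = D
    generalize √(x t ^ 2 + y t ^ 2) = r at hr hsq ⊢
    have hx2 : x t ^ 2 = r ^ 2 - y t ^ 2 := by linarith
    field_simp
    simp
    grind
  exact is_const_of_deriv_eq_zero (fun t => (hder t).differentiableAt) fun t => (hder t).deriv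
end

section
/- (New integrable potential V₂₈ from a constant Killing tensor.) Let A, B, C be real constants with C ≠ 0, set b₀ = (A − B)/(2C), and let F₁, F₂ : ℝ → ℝ be C² functions. Define V(x,y) = F₁(y + b₀ x + √(b₀² + 1) x) + F₂(y + b₀ x − √(b₀² + 1) x). Along every C² solution (x(t), y(t)) of ẍ = −V_x, ÿ = −V_y, the quantity I₈₁ = A ẋ² + B ẏ² + 2C ẋ ẏ + (A + B) V(x,y) + 2C √(b₀² + 1) (F₁(y + b₀ x + √(b₀² + 1) x) − F₂(y + b₀ x − √(b₀² + 1) x)) is constant in t. In particular, for A = B (so b₀ = 0) and C = 1/2 one recovers that for V(x,y) = F₁(y + x) + F₂(y − x) the quantity I₈₂ = ẋ ẏ + F₁(y + x) − F₂(y − x) is constant along solutions. -/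
open Real

/-- The differential of a sum of two plane waves `F₁(y + bx + sx) + F₂(y + bx - sx)`. -/
theorem fderiv_planeWaves {F₁ F₂ : ℝ → ℝ} (h₁ : Differentiable ℝ F₁) (h₂ : Differentiable ℝ F₂)
    (b s : ℝ) (p v : ℝ × ℝ) :
    fderiv ℝ (fun p : ℝ × ℝ => F₁ (p.2 + b * p.1 + s * p.1) + F₂ (p.2 + b * p.1 - s * p.1)) p v
      = deriv F₁ (p.2 + b * p.1 + s * p.1) * (v.2 + b * v.1 + s * v.1)
        + deriv F₂ (p.2 + b * p.1 - s * p.1) * (v.2 + b * v.1 - s * v.1) := by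
  have hx : HasFDerivAt (fun p : ℝ × ℝ => p.1) (ContinuousLinearMap.fst ℝ ℝ ℝ) p := hasFDerivAt_fst
  have hy : HasFDerivAt (fun p : ℝ × ℝ => p.2) (ContinuousLinearMap.snd ℝ ℝ ℝ) p := hasFDerivAt_snd
  have hw := hy.add (hx.const_mul b)
  have hF₁ := (h₁ (p.2 + b * p.1 + s * p.1)).hasDerivAt.comp_hasFDerivAt p
    (hw.add (hx.const_mul s))
  have hF₂ := (h₂ (p.2 + b * p.1 - s * p.1)).hasDerivAt.comp_hasFDerivAt p
    (hw.sub (hx.const_mul s))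
  have h := (hF₁.add hF₂).fderiv
  exact (congrArg (fun L : ℝ × ℝ →L[ℝ] ℝ => L v) h).trans (by simp; ring)

/-- The quadratic first integral of the Killing tensor with constant entries `A`, `B`, `C`, for the
potential `F₁(y + bx + sx) + F₂(y + bx - sx)`. -/
theorem quadraticIntegral_planeWaves {A B C b s : ℝ} (hb : A - B = 2 * C * b)
    (hs : s ^ 2 = b ^ 2 + 1) {F₁ F₂ : ℝ → ℝ}
    (h₁ : Differentiable ℝ F₁) (h₂ : Differentiable ℝ F₂) {x y x' y' : ℝ → ℝ}
    (hx : ∀ t, HasDerivAt x (x' t) t) (hy : ∀ t, HasDerivAt y (y' t) t)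
    (hx' : ∀ t, HasDerivAt x' (-(pX (fun p : ℝ × ℝ =>
      F₁ (p.2 + b * p.1 + s * p.1) + F₂ (p.2 + b * p.1 - s * p.1)) (x t, y t))) t)
    (hy' : ∀ t, HasDerivAt y' (-(pY (fun p : ℝ × ℝ =>
      F₁ (p.2 + b * p.1 + s * p.1) + F₂ (p.2 + b * p.1 - s * p.1)) (x t, y t))) t)
    (t₁ t₂ : ℝ) :
    A * (x' t₁) ^ 2 + B * (y' t₁) ^ 2 + 2 * C * x' t₁ * y' t₁
      + (A + B) * (F₁ (y t₁ + b * x t₁ + s * x t₁) + F₂ (y t₁ + b * x t₁ - s * x t₁))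
      + 2 * C * s * (F₁ (y t₁ + b * x t₁ + s * x t₁) - F₂ (y t₁ + b * x t₁ - s * x t₁))
    = A * (x' t₂) ^ 2 + B * (y' t₂) ^ 2 + 2 * C * x' t₂ * y' t₂
      + (A + B) * (F₁ (y t₂ + b * x t₂ + s * x t₂) + F₂ (y t₂ + b * x t₂ - s * x t₂))
      + 2 * C * s * (F₁ (y t₂ + b * x t₂ + s * x t₂) - F₂ (y t₂ + b * x t₂ - s * x t₂)) := by
  simp only [pX, pY, fderiv_planeWaves h₁ h₂] at hx' hy'
  have key : ∀ t, HasDerivAt (fun t => A * (x' t) ^ 2 + B * (y' t) ^ 2 + 2 * C * x' t * y' t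
      + (A + B) * (F₁ (y t + b * x t + s * x t) + F₂ (y t + b * x t - s * x t))
      + 2 * C * s * (F₁ (y t + b * x t + s * x t) - F₂ (y t + b * x t - s * x t))) 0 t := by
    intro t
    have hw := (hy t).add ((hx t).const_mul b)
    have hF₁ := (h₁ (y t + b * x t + s * x t)).hasDerivAt.comp t (hw.add ((hx t).const_mul s))
    have hF₂ := (h₂ (y t + b * x t - s * x t)).hasDerivAt.comp t (hw.sub ((hx t).const_mul s))
    have h := (((((hx' t).pow 2).const_mul A).add (((hy' t).pow 2).const_mul B)).add
      (((hx' t).const_mul (2 * C)).mul (hy' t))).add ((hF₁.add hF₂).const_mul (A + B)) |>.add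
      ((hF₁.sub hF₂).const_mul (2 * C * s))
    refine h.congr_deriv ?_
    obtain rfl : A = B + 2 * C * b := by linarith
    push_cast
    linear_combination (2 * C * x' t * (deriv F₁ (y t + b * x t + s * x t)
      + deriv F₂ (y t + b * x t - s * x t))) * hs
  exact is_const_of_deriv_eq_zero (fun t => (key t).differentiableAt) (fun t => (key t).deriv) t₁ t₂

/-- New integrable potential `V₂₈` from a constant Killing tensor: for
`V = F₁(y + b₀x + √(b₀²+1)x) + F₂(y + b₀x − √(b₀²+1)x)` with `b₀ = (A−B)/(2C)`,
the quantity `I₈₁` is constant along solutions; in particular for `A = B`,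
`C = 1/2` the quantity `I₈₂ = ẋẏ + F₁(y+x) − F₂(y−x)` is constant along
solutions for `V = F₁(y+x) + F₂(y−x)`. -/
theorem stmt17 :
    (∀ (A B C : ℝ), C ≠ 0 → ∀ (F₁ F₂ : ℝ → ℝ), ContDiff ℝ 2 F₁ → ContDiff ℝ 2 F₂ →
      ∀ (x y x' y' : ℝ → ℝ),
        (∀ t, HasDerivAt x (x' t) t) → (∀ t, HasDerivAt y (y' t) t) →
        (∀ t, HasDerivAt x'
          (-(pX (fun p : ℝ × ℝ =>
              F₁ (p.2 + (A - B) / (2 * C) * p.1 + Real.sqrt (((A - B) / (2 * C))^2 + 1) * p.1)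
            + F₂ (p.2 + (A - B) / (2 * C) * p.1 - Real.sqrt (((A - B) / (2 * C))^2 + 1) * p.1))
            (x t, y t))) t) →
        (∀ t, HasDerivAt y'
          (-(pY (fun p : ℝ × ℝ =>
              F₁ (p.2 + (A - B) / (2 * C) * p.1 + Real.sqrt (((A - B) / (2 * C))^2 + 1) * p.1)
            + F₂ (p.2 + (A - B) / (2 * C) * p.1 - Real.sqrt (((A - B) / (2 * C))^2 + 1) * p.1))
            (x t, y t))) t) →
        ∀ t₁ t₂,
          A * (x' t₁)^2 + B * (y' t₁)^2 + 2 * C * x' t₁ * y' t₁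
            + (A + B) * (F₁ (y t₁ + (A - B) / (2 * C) * x t₁
                  + Real.sqrt (((A - B) / (2 * C))^2 + 1) * x t₁)
               + F₂ (y t₁ + (A - B) / (2 * C) * x t₁
                  - Real.sqrt (((A - B) / (2 * C))^2 + 1) * x t₁))
            + 2 * C * Real.sqrt (((A - B) / (2 * C))^2 + 1)
              * (F₁ (y t₁ + (A - B) / (2 * C) * x t₁
                  + Real.sqrt (((A - B) / (2 * C))^2 + 1) * x t₁)
               - F₂ (y t₁ + (A - B) / (2 * C) * x t₁
                  - Real.sqrt (((A - B) / (2 * C))^2 + 1) * x t₁))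
          = A * (x' t₂)^2 + B * (y' t₂)^2 + 2 * C * x' t₂ * y' t₂
            + (A + B) * (F₁ (y t₂ + (A - B) / (2 * C) * x t₂
                  + Real.sqrt (((A - B) / (2 * C))^2 + 1) * x t₂)
               + F₂ (y t₂ + (A - B) / (2 * C) * x t₂
                  - Real.sqrt (((A - B) / (2 * C))^2 + 1) * x t₂))
            + 2 * C * Real.sqrt (((A - B) / (2 * C))^2 + 1)
              * (F₁ (y t₂ + (A - B) / (2 * C) * x t₂
                  + Real.sqrt (((A - B) / (2 * C))^2 + 1) * x t₂)
               - F₂ (y t₂ + (A - B) / (2 * C) * x t₂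
                  - Real.sqrt (((A - B) / (2 * C))^2 + 1) * x t₂)))
    ∧
    (∀ (F₁ F₂ : ℝ → ℝ), ContDiff ℝ 2 F₁ → ContDiff ℝ 2 F₂ →
      ∀ (x y x' y' : ℝ → ℝ),
        (∀ t, HasDerivAt x (x' t) t) → (∀ t, HasDerivAt y (y' t) t) →
        (∀ t, HasDerivAt x'
          (-(pX (fun p : ℝ × ℝ => F₁ (p.2 + p.1) + F₂ (p.2 - p.1)) (x t, y t))) t) →
        (∀ t, HasDerivAt y'
          (-(pY (fun p : ℝ × ℝ => F₁ (p.2 + p.1) + F₂ (p.2 - p.1)) (x t, y t))) t) →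
        ∀ t₁ t₂,
          x' t₁ * y' t₁ + F₁ (y t₁ + x t₁) - F₂ (y t₁ - x t₁)
          = x' t₂ * y' t₂ + F₁ (y t₂ + x t₂) - F₂ (y t₂ - x t₂)) := by
  refine ⟨fun A B C hC F₁ F₂ h₁ h₂ x y x' y' hx hy hx' hy' t₁ t₂ => ?_,
    fun F₁ F₂ h₁ h₂ x y x' y' hx hy hx' hy' t₁ t₂ => ?_⟩
  · exact quadraticIntegral_planeWaves (by field_simp) (Real.sq_sqrt (by positivity))
      (h₁.differentiable (by norm_num)) (h₂.differentiable (by norm_num)) hx hy hx' hy' t₁ t₂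
  · have h := quadraticIntegral_planeWaves (A := 0) (B := 0) (C := 1 / 2) (b := 0) (s := 1)
      (by norm_num) (by norm_num) (h₁.differentiable (by norm_num))
      (h₂.differentiable (by norm_num)) hx hy (by simpa using hx') (by simpa using hy') t₁ t₂
    norm_num at h
    linarith
end

section
/- (Exponential time-dependent quadratic first integrals of the potential V₂₇₄.) Let λ ≠ 0 and c₁, c₂, k₁, k₂ be real constants and, on the open set {(x,y) : x ≠ −c₁ and y ≠ −c₂}, set V(x,y) = −(λ²/8)(x² + y²) − (λ²/4)(c₁ x + c₂ y) − k₁/(x + c₁)² − k₂/(y + c₂)². Along every C² solution (x(t), y(t)) of ẍ = −V_x, ÿ = −V_y remaining in this set, the quantities I₇₃a = e^{λ t} [ −ẋ² + λ(x + c₁) ẋ − (λ²/4)(x + c₁)² + 2k₁/(x + c₁)² ] and I₇₃b = e^{λ t} [ −ẏ² + λ(y + c₂) ẏ − (λ²/4)(y + c₂)² + 2k₂/(y + c₂)² ] are each constant in t. -/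
open Real

/-- The derivative of each one-variable summand of the potential. -/
theorem hasDerivAt_separated_potential (a c k s : ℝ) (hs : s ≠ -c) :
    HasDerivAt (fun s : ℝ => -(a^2 / 8) * s^2 - a^2 / 4 * (c * s) - k / (s + c)^2)
      (-(a ^ 2 / 4 * (s + c) - 2 * k / (s + c) ^ 3)) s := by
  have h0 : s + c ≠ 0 := fun h => hs (by linarith)
  have hid := hasDerivAt_id s
  have h := (((hid.pow 2).const_mul (-(a^2 / 8))).sub ((hid.const_mul c).const_mul (a^2 / 4))).sub
    ((hasDerivAt_const s k).div ((hid.add_const c).pow 2) (pow_ne_zero 2 h0))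
  refine h.congr_deriv ?_
  simp
  field_simp
  ring

/-- Solutions of `u'' = (a²/4)u - 2k/u³` with `u ≠ 0` conserve the exponential quadratic integral. -/
theorem exp_quadratic_integral_eq (a c k : ℝ) (u v : ℝ → ℝ) (hu0 : ∀ t, u t ≠ -c)
    (hu : ∀ t, HasDerivAt u (v t) t)
    (hv : ∀ t, HasDerivAt v (a ^ 2 / 4 * (u t + c) - 2 * k / (u t + c) ^ 3) t) (t₁ t₂ : ℝ) :
    exp (a * t₁) * (-(v t₁)^2 + a * (u t₁ + c) * v t₁
        - a^2 / 4 * (u t₁ + c)^2 + 2 * k / (u t₁ + c)^2)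
      = exp (a * t₂) * (-(v t₂)^2 + a * (u t₂ + c) * v t₂
        - a^2 / 4 * (u t₂ + c)^2 + 2 * k / (u t₂ + c)^2) := by
  have key : ∀ t, HasDerivAt (fun t => exp (a * t) * (-(v t)^2 + a * (u t + c) * v t
      - a^2 / 4 * (u t + c)^2 + 2 * k / (u t + c)^2)) 0 t := by
    intro t
    have h0 : u t + c ≠ 0 := fun h => hu0 t (by linarith)
    have huc := (hu t).add_const c
    have hE := ((hasDerivAt_id t).const_mul a).exp
    have h := hE.mul ((((((hv t).pow 2).neg).add ((huc.const_mul a).mul (hv t))).sub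
      ((huc.pow 2).const_mul (a^2 / 4))).add
      ((hasDerivAt_const t (2 * k)).div (huc.pow 2) (pow_ne_zero 2 h0)))
    refine h.congr_deriv ?_
    simp
    field_simp
    ring
  exact is_const_of_deriv_eq_zero (fun t => (key t).differentiableAt) (fun t => (key t).deriv) t₁ t₂

/-- The total derivative of the potential off its singular lines. -/
theorem fderiv_potential_apply (a c d k l : ℝ) (p w : ℝ × ℝ) (hp : p.1 ≠ -c) (hq : p.2 ≠ -d) :
    fderiv ℝ (fun p : ℝ × ℝ => -(a^2 / 8) * (p.1^2 + p.2^2)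
        - a^2 / 4 * (c * p.1 + d * p.2) - k / (p.1 + c)^2 - l / (p.2 + d)^2) p w
      = -(a ^ 2 / 4 * (p.1 + c) - 2 * k / (p.1 + c) ^ 3) * w.1
        - (a ^ 2 / 4 * (p.2 + d) - 2 * l / (p.2 + d) ^ 3) * w.2 := by
  have f1 : HasFDerivAt (fun p : ℝ × ℝ => p.1) (ContinuousLinearMap.fst ℝ ℝ ℝ) p := hasFDerivAt_fst
  have f2 : HasFDerivAt (fun p : ℝ × ℝ => p.2) (ContinuousLinearMap.snd ℝ ℝ ℝ) p := hasFDerivAt_snd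
  have g1 := hasDerivAt_separated_potential a c k p.1 hp
  have g2 := hasDerivAt_separated_potential a d l p.2 hq
  have h := (g1.comp_hasFDerivAt p f1).add (g2.comp_hasFDerivAt p f2)
  have e : (fun p : ℝ × ℝ => -(a^2 / 8) * (p.1^2 + p.2^2)
        - a^2 / 4 * (c * p.1 + d * p.2) - k / (p.1 + c)^2 - l / (p.2 + d)^2)
      = ((fun s : ℝ => -(a^2 / 8) * s^2 - a^2 / 4 * (c * s) - k / (s + c)^2) ∘ fun p : ℝ × ℝ => p.1)
        + ((fun s : ℝ => -(a^2 / 8) * s^2 - a^2 / 4 * (d * s) - l / (s + d)^2) ∘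
          fun p : ℝ × ℝ => p.2) := by
    funext p
    simp only [Pi.add_apply, Function.comp_apply]
    ring
  rw [e, h.fderiv]
  simp
  ring

/-- Exponential time-dependent quadratic first integrals of
`V₂₇₄ = −(λ²/8)(x²+y²) − (λ²/4)(c₁x + c₂y) − k₁/(x+c₁)² − k₂/(y+c₂)²` on the set
`{x ≠ −c₁, y ≠ −c₂}`: the quantities `I₇₃a`, `I₇₃b` are constant along solutions
remaining in this set. -/
theorem stmt19 (lam c₁ c₂ k₁ k₂ : ℝ) (hlam : lam ≠ 0)
    (x y x' y' : ℝ → ℝ) (hdom : ∀ t, x t ≠ -c₁ ∧ y t ≠ -c₂)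
    (hx : ∀ t, HasDerivAt x (x' t) t) (hy : ∀ t, HasDerivAt y (y' t) t)
    (hx' : ∀ t, HasDerivAt x'
      (-(pX (fun p : ℝ × ℝ => -(lam^2 / 8) * (p.1^2 + p.2^2)
          - lam^2 / 4 * (c₁ * p.1 + c₂ * p.2)
          - k₁ / (p.1 + c₁)^2 - k₂ / (p.2 + c₂)^2) (x t, y t))) t)
    (hy' : ∀ t, HasDerivAt y'
      (-(pY (fun p : ℝ × ℝ => -(lam^2 / 8) * (p.1^2 + p.2^2)
          - lam^2 / 4 * (c₁ * p.1 + c₂ * p.2)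
          - k₁ / (p.1 + c₁)^2 - k₂ / (p.2 + c₂)^2) (x t, y t))) t) :
    (∀ t₁ t₂, exp (lam * t₁) * (-(x' t₁)^2 + lam * (x t₁ + c₁) * x' t₁
                - lam^2 / 4 * (x t₁ + c₁)^2 + 2 * k₁ / (x t₁ + c₁)^2)
            = exp (lam * t₂) * (-(x' t₂)^2 + lam * (x t₂ + c₁) * x' t₂
                - lam^2 / 4 * (x t₂ + c₁)^2 + 2 * k₁ / (x t₂ + c₁)^2)) ∧
    (∀ t₁ t₂, exp (lam * t₁) * (-(y' t₁)^2 + lam * (y t₁ + c₂) * y' t₁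
                - lam^2 / 4 * (y t₁ + c₂)^2 + 2 * k₂ / (y t₁ + c₂)^2)
            = exp (lam * t₂) * (-(y' t₂)^2 + lam * (y t₂ + c₂) * y' t₂
                - lam^2 / 4 * (y t₂ + c₂)^2 + 2 * k₂ / (y t₂ + c₂)^2)) := by
  constructor
  · refine exp_quadratic_integral_eq lam c₁ k₁ x x' (fun t => (hdom t).1) hx fun t => ?_
    refine (hx' t).congr_deriv ?_
    rw [pX, fderiv_potential_apply _ _ _ _ _ _ _ (hdom t).1 (hdom t).2]
    ring
  · refine exp_quadratic_integral_eq lam c₂ k₂ y y' (fun t => (hdom t).2) hy fun t => ?_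
    refine (hy' t).congr_deriv ?_
    rw [pY, fderiv_potential_apply _ _ _ _ _ _ _ (hdom t).1 (hdom t).2]
    ring
end
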